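/- arXiv:1309.1564 — 9 statements merged into one kernel-verified Lean document; each statement's English description precedes it below -/
import Mathlib

section
/- Let A be an m×n integer matrix with rows A_1,…,A_m ∈ ℤⁿ, let c ∈ ℂ^m, and fix j ∈ {1,…,m}. Let U ⊆ {x ∈ ℂⁿ : x_1⋯x_n ≠ 0} be open and let f be holomorphic on U. If f satisfies every equation of the Horn system Horn(A, c − e_j) on U (where e_j ∈ ℂ^m is the j-th standard basis vector), then the function g := ⟨A_j, θ⟩f + (c_j − 1)f satisfies every equation of the Horn system Horn(A, c) on U. (Intertwining operator for monodromy representations of Horn systems.) -/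
open scoped BigOperators

/-- The operator `θ_k = x_k ∂/∂x_k` acting on functions of `n` complex variables. -/
noncomputable def th {n : ℕ} (k : Fin n) (f : (Fin n → ℂ) → ℂ) : (Fin n → ℂ) → ℂ :=
  fun x => x k * fderiv ℂ f x (Pi.single k 1)

/-- The first-order operator `⟨a, θ⟩ + c`. -/
noncomputable def linFactor {n : ℕ} (a : Fin n → ℤ) (c : ℂ) (f : (Fin n → ℂ) → ℂ) :
    (Fin n → ℂ) → ℂ :=
  fun x => (∑ k, (a k : ℂ) * th k f x) + c * f x

/-- The operator `∏_{ℓ=0}^{N-1} (⟨a, θ⟩ + c + ℓ)` (the factors commute). -/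
noncomputable def factorPow {n : ℕ} (a : Fin n → ℤ) (c : ℂ) :
    ℕ → ((Fin n → ℂ) → ℂ) → ((Fin n → ℂ) → ℂ)
  | 0 => id
  | N + 1 => fun f => linFactor a (c + N) (factorPow a c N f)

/-- The operator `P_k(θ)` of the Horn system `Horn(A, c)`. -/
noncomputable def Pop {m n : ℕ} (A : Fin m → Fin n → ℤ) (c : Fin m → ℂ) (k : Fin n)
    (f : (Fin n → ℂ) → ℂ) : (Fin n → ℂ) → ℂ :=
  (List.finRange m).foldr
    (fun i g => if 0 < A i k then factorPow (A i) (c i) (A i k).toNat g else g) f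

/-- The operator `Q_k(θ)` of the Horn system `Horn(A, c)`. -/
noncomputable def Qop {m n : ℕ} (A : Fin m → Fin n → ℤ) (c : Fin m → ℂ) (k : Fin n)
    (f : (Fin n → ℂ) → ℂ) : (Fin n → ℂ) → ℂ :=
  (List.finRange m).foldr
    (fun i g => if A i k < 0 then factorPow (A i) (c i) (A i k).natAbs g else g) f

/-- `f` satisfies every equation `x_k P_k(θ) f = Q_k(θ) f` of `Horn(A, c)` on `U`. -/
def HornSol {m n : ℕ} (A : Fin m → Fin n → ℤ) (c : Fin m → ℂ) (U : Set (Fin n → ℂ))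
    (f : (Fin n → ℂ) → ℂ) : Prop :=
  ∀ k : Fin n, ∀ x ∈ U, x k * Pop A c k f x = Qop A c k f x

/-- The linear vector field `x ↦ (a_k x_k)_k`, along which `⟨a, θ⟩` differentiates. -/
noncomputable def eulerField {n : ℕ} (a : Fin n → ℤ) : (Fin n → ℂ) →L[ℂ] (Fin n → ℂ) :=
  ContinuousLinearMap.pi fun k => (a k : ℂ) • ContinuousLinearMap.proj k

lemma eulerField_apply {n : ℕ} (a : Fin n → ℤ) (x : Fin n → ℂ) (k : Fin n) :
    eulerField a x k = a k * x k := by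
  simp [eulerField]

lemma linFactor_apply {n : ℕ} (a : Fin n → ℤ) (c : ℂ) (f : (Fin n → ℂ) → ℂ) (x : Fin n → ℂ) :
    linFactor a c f x = fderiv ℂ f x (eulerField a x) + c * f x := by
  have h : eulerField a x = ∑ k, ((a k : ℂ) * x k) • (Pi.single k 1 : Fin n → ℂ) := by
    ext i
    simp [eulerField_apply, Finset.sum_apply, Pi.single_apply]
  simp only [linFactor, th, h, map_sum, map_smul, smul_eq_mul, mul_assoc]

lemma linFactor_eq {n : ℕ} (a : Fin n → ℤ) (c : ℂ) (f : (Fin n → ℂ) → ℂ) :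
    linFactor a c f = fun x => fderiv ℂ f x (eulerField a x) + c * f x :=
  funext (linFactor_apply a c f)

section

variable {n : ℕ} {U : Set (Fin n → ℂ)} {f g : (Fin n → ℂ) → ℂ}

lemma AnalyticOnNhd.horn_linFactor (hf : AnalyticOnNhd ℂ f U) (a : Fin n → ℤ) (c : ℂ) :
    AnalyticOnNhd ℂ (linFactor a c f) U := by
  rw [linFactor_eq]
  intro x hx
  have h := (((ContinuousLinearMap.id ℂ ((Fin n → ℂ) →L[ℂ] ℂ)).analyticAt_bilinear
    (fderiv ℂ f x, eulerField a x))).comp₂ (hf x hx).fderiv ((eulerField a).analyticAt x)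
  exact h.add (analyticAt_const.mul (hf x hx))

lemma AnalyticOnNhd.horn_factorPow (hf : AnalyticOnNhd ℂ f U) (a : Fin n → ℤ) (c : ℂ) (N : ℕ) :
    AnalyticOnNhd ℂ (factorPow a c N f) U := by
  induction N with
  | zero => exact hf
  | succ N ih => exact ih.horn_linFactor a _

lemma Set.EqOn.horn_linFactor (hU : IsOpen U) (h : U.EqOn f g) (a : Fin n → ℤ) (c : ℂ) :
    U.EqOn (linFactor a c f) (linFactor a c g) := by
  intro x hx
  have h' : f =ᶠ[nhds x] g := h.eventuallyEq_of_mem (hU.mem_nhds hx)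
  rw [linFactor_apply, linFactor_apply, h'.fderiv_eq, h hx]

lemma Set.EqOn.horn_factorPow (hU : IsOpen U) (h : U.EqOn f g) (a : Fin n → ℤ) (c : ℂ) (N : ℕ) :
    U.EqOn (factorPow a c N f) (factorPow a c N g) := by
  induction N with
  | zero => exact h
  | succ N ih => exact ih.horn_linFactor hU a _

lemma linFactor_linFactor_apply {x : Fin n → ℂ} (hf : AnalyticAt ℂ f x) (a b : Fin n → ℤ)
    (c d : ℂ) :
    linFactor a c (linFactor b d f) x =
      fderiv ℂ (fderiv ℂ f) x (eulerField a x) (eulerField b x)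
        + fderiv ℂ f x (eulerField b (eulerField a x))
        + d * fderiv ℂ f x (eulerField a x) + c * fderiv ℂ f x (eulerField b x)
        + c * d * f x := by
  have h := (hf.fderiv.differentiableAt.hasFDerivAt.clm_apply
    (eulerField b).hasFDerivAt).add (hf.differentiableAt.hasFDerivAt.const_mul d)
  have h' : fderiv ℂ (fun y => fderiv ℂ f y (eulerField b y) + d * f y) x = _ :=
    HasFDerivAt.fderiv h
  rw [linFactor_apply, linFactor_eq b d f, h']
  simp
  ring

lemma linFactor_comm (hf : AnalyticOnNhd ℂ f U) (a b : Fin n → ℤ) (c d : ℂ) :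
    U.EqOn (linFactor a c (linFactor b d f)) (linFactor b d (linFactor a c f)) := by
  intro x hx
  have hs : IsSymmSndFDerivAt ℂ f x :=
    (hf x hx).contDiffAt.isSymmSndFDerivAt (n := ⊤) (by simp)
  have hab : eulerField b (eulerField a x) = eulerField a (eulerField b x) := by
    ext k
    simp only [eulerField_apply]
    ring
  rw [linFactor_linFactor_apply (hf x hx), linFactor_linFactor_apply (hf x hx), hab,
    hs.eq (eulerField a x) (eulerField b x)]
  ring

lemma factorPow_linFactor_comm (hU : IsOpen U) (hf : AnalyticOnNhd ℂ f U) (a b : Fin n → ℤ)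
    (c d : ℂ) (N : ℕ) :
    U.EqOn (factorPow a c N (linFactor b d f)) (linFactor b d (factorPow a c N f)) := by
  induction N with
  | zero => exact Set.eqOn_refl _ _
  | succ N ih =>
    exact (ih.horn_linFactor hU a _).trans (linFactor_comm (hf.horn_factorPow a c N) a b _ d)

lemma factorPow_linFactor_sub_one (a : Fin n → ℤ) (c : ℂ) (N : ℕ) (f : (Fin n → ℂ) → ℂ) :
    factorPow a c N (linFactor a (c - 1) f) =
      linFactor a (c - 1 + N) (factorPow a (c - 1) N f) := by
  induction N with
  | zero => simp [factorPow]
  | succ N ih =>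
    have h : c - 1 + ((N + 1 : ℕ) : ℂ) = c + N := by
      push_cast
      ring
    rw [h]
    simp only [factorPow, ih]

lemma linFactor_coord_mul {x : Fin n → ℂ} (hf : DifferentiableAt ℂ f x) (a : Fin n → ℤ) (c : ℂ)
    (k : Fin n) :
    linFactor a c (fun y => y k * f y) x = x k * linFactor a (c + a k) f x := by
  have h := (ContinuousLinearMap.proj (R := ℂ) (φ := fun _ : Fin n => ℂ) k).hasFDerivAt
    (x := x) |>.mul hf.hasFDerivAt
  have h' : fderiv ℂ (fun y => y k * f y) x = _ := HasFDerivAt.fderiv h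
  rw [linFactor_apply, linFactor_apply, h']
  simp [eulerField_apply]
  ring

end

/-- The operator `∏_{i ∈ l} ∏_{ℓ=0}^{N_i-1} (⟨A_i, θ⟩ + c_i + ℓ)`. -/
noncomputable def factorProd {m n : ℕ} (A : Fin m → Fin n → ℤ) (c : Fin m → ℂ) (N : Fin m → ℕ)
    (l : List (Fin m)) (f : (Fin n → ℂ) → ℂ) : (Fin n → ℂ) → ℂ :=
  l.foldr (fun i g => factorPow (A i) (c i) (N i) g) f

lemma Pop_eq_factorProd {m n : ℕ} (A : Fin m → Fin n → ℤ) (c : Fin m → ℂ) (k : Fin n)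
    (f : (Fin n → ℂ) → ℂ) :
    Pop A c k f = factorProd A c (fun i => (A i k).toNat) (List.finRange m) f := by
  unfold Pop factorProd
  congr 1
  funext i g
  split_ifs with h
  · rfl
  · simp [Int.toNat_of_nonpos (not_lt.mp h), factorPow]

lemma Qop_eq_factorProd {m n : ℕ} (A : Fin m → Fin n → ℤ) (c : Fin m → ℂ) (k : Fin n)
    (f : (Fin n → ℂ) → ℂ) :
    Qop A c k f = factorProd A c (fun i => (-A i k).toNat) (List.finRange m) f := by
  unfold Qop factorProd
  congr 1
  funext i g
  split_ifs with h
  · have h' : (A i k).natAbs = (-A i k).toNat := by omega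
    rw [h']
  · simp [Int.toNat_of_nonpos (show -A i k ≤ 0 by omega), factorPow]

section

variable {m n : ℕ} {U : Set (Fin n → ℂ)} {f : (Fin n → ℂ) → ℂ}

lemma AnalyticOnNhd.horn_factorProd (hf : AnalyticOnNhd ℂ f U) (A : Fin m → Fin n → ℤ)
    (c : Fin m → ℂ) (N : Fin m → ℕ) (l : List (Fin m)) :
    AnalyticOnNhd ℂ (factorProd A c N l f) U := by
  induction l with
  | nil => exact hf
  | cons i l ih => exact ih.horn_factorPow (A i) (c i) (N i)

lemma factorProd_linFactor (hU : IsOpen U) (hf : AnalyticOnNhd ℂ f U) (A : Fin m → Fin n → ℤ)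
    (c : Fin m → ℂ) (N : Fin m → ℕ) (j : Fin m) {l : List (Fin m)} (hl : l.Nodup) :
    U.EqOn (factorProd A c N l (linFactor (A j) (c j - 1) f))
      (linFactor (A j) (c j - 1 + if j ∈ l then (N j : ℂ) else 0)
        (factorProd A (c - Pi.single j 1) N l f)) := by
  induction l with
  | nil => simp [factorProd, Set.eqOn_refl]
  | cons i l ih =>
    obtain ⟨hi, hl⟩ := List.nodup_cons.mp hl
    have han := hf.horn_factorProd A (c - Pi.single j 1) N l
    have h := (ih hl).horn_factorPow hU (A i) (c i) (N i)
    by_cases hij : i = j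
    · subst hij
      rw [if_neg hi, add_zero, factorPow_linFactor_sub_one] at h
      simpa [factorProd] using h
    · have h' := h.trans (factorPow_linFactor_comm hU han _ _ _ _ _)
      simpa [factorProd, hij, Ne.symm hij] using h'

end

/-- Intertwining operator for monodromy representations of Horn systems:
if `f` solves `Horn(A, c - e_j)` on `U`, then `⟨A_j, θ⟩ f + (c_j - 1) f` solves
`Horn(A, c)` on `U`. -/
theorem stmt0 {m n : ℕ} (A : Fin m → Fin n → ℤ) (c : Fin m → ℂ) (j : Fin m)
    (U : Set (Fin n → ℂ)) (hUopen : IsOpen U) (hU : U ⊆ {x | (∏ k, x k) ≠ 0})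
    (f : (Fin n → ℂ) → ℂ) (hf : AnalyticOnNhd ℂ f U)
    (hsol : HornSol A (c - Pi.single j 1) U f) :
    HornSol A c U (fun x => (∑ k, (A j k : ℂ) * th k f x) + (c j - 1) * f x) := by
  intro k x hx
  have hP := factorProd_linFactor hUopen hf A c (fun i => (A i k).toNat) j
    (List.nodup_finRange m)
  have hQ := factorProd_linFactor hUopen hf A c (fun i => (-A i k).toNat) j
    (List.nodup_finRange m)
  simp only [List.mem_finRange, if_true, ← Pop_eq_factorProd, ← Qop_eq_factorProd] at hP hQ
  have hdiff : DifferentiableAt ℂ (Pop A (c - Pi.single j 1) k f) x := by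
    rw [Pop_eq_factorProd]
    exact (hf.horn_factorProd A _ _ _ x hx).differentiableAt
  have hcast : c j - 1 + ((A j k).toNat : ℂ) = c j - 1 + ((-A j k).toNat : ℂ) + A j k := by
    have h : ((A j k).toNat : ℤ) = (-A j k).toNat + A j k := by omega
    have h' : ((A j k).toNat : ℂ) = (-A j k).toNat + A j k := by exact_mod_cast h
    rw [h', add_assoc]
  change x k * Pop A c k (linFactor (A j) (c j - 1) f) x =
    Qop A c k (linFactor (A j) (c j - 1) f) x
  rw [hP hx, hQ hx, hcast, ← linFactor_coord_mul hdiff]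
  exact Set.EqOn.horn_linFactor hUopen (fun y hy => hsol k y hy) _ _ hx
end

section
/- Let a_1, b_1 be positive integers and a_2, b_2 negative integers, let c̃ = (c̃_1, c̃_2) ∈ ℂ², and let u, v be integers with 0 ≤ u < min(a_1, b_1) and 0 ≤ v < min(|a_2|, |b_2|). Suppose α ∈ ℂ² satisfies a_1α_1 + b_1α_2 + c̃_1 + u = 0 and a_2α_1 + b_2α_2 + c̃_2 + v = 0. Then P_1(α) = P_2(α) = Q_1(α) = Q_2(α) = 0, where P_1(s) = ∏_{ℓ=0}^{a_1−1}(a_1s_1 + b_1s_2 + c̃_1 + ℓ), P_2(s) = ∏_{ℓ=0}^{b_1−1}(a_1s_1 + b_1s_2 + c̃_1 + ℓ), Q_1(s) = ∏_{ℓ=0}^{|a_2|−1}(a_2s_1 + b_2s_2 + c̃_2 + ℓ), Q_2(s) = ∏_{ℓ=0}^{|b_2|−1}(a_2s_1 + b_2s_2 + c̃_2 + ℓ). Consequently the Puiseux monomial f(x) = x_1^{α_1} x_2^{α_2}, defined with principal branches on (ℂ∖(−∞,0])², satisfies both equations x_1 P_1(θ)f = Q_1(θ)f and x_2 P_2(θ)f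 = Q_2(θ)f of the atomic Horn system. (Persistent monomial solutions of a bivariate atomic Horn system.) -/
open scoped BigOperators

/-- The operator `θ₁ = x₁ ∂/∂x₁` acting on functions of two complex variables. -/
noncomputable def th1 (f : ℂ × ℂ → ℂ) : ℂ × ℂ → ℂ := fun p => p.1 * fderiv ℂ f p (1, 0)

/-- The operator `θ₂ = x₂ ∂/∂x₂` acting on functions of two complex variables. -/
noncomputable def th2 (f : ℂ × ℂ → ℂ) : ℂ × ℂ → ℂ := fun p => p.2 * fderiv ℂ f p (0, 1)

/-- The first-order operator `a θ₁ + b θ₂ + c`. -/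
noncomputable def lin2 (a b c : ℂ) (f : ℂ × ℂ → ℂ) : ℂ × ℂ → ℂ :=
  fun p => a * th1 f p + b * th2 f p + c * f p

/-- The operator `∏_{ℓ=0}^{N-1} (a θ₁ + b θ₂ + c + ℓ)` (the factors commute). -/
noncomputable def linPow2 (a b c : ℂ) : ℕ → (ℂ × ℂ → ℂ) → (ℂ × ℂ → ℂ)
  | 0 => id
  | N + 1 => fun f => lin2 a b (c + N) (linPow2 a b c N f)

/-- The monomial `x₁^{α₁} x₂^{α₂}` has the expected total derivative off the branch cuts. -/
theorem hasFDerivAt_monomial (α p : ℂ × ℂ) (h1 : p.1 ∈ Complex.slitPlane)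
    (h2 : p.2 ∈ Complex.slitPlane) :
    HasFDerivAt (fun q : ℂ × ℂ => q.1 ^ α.1 * q.2 ^ α.2)
      (p.1 ^ α.1 • ((α.2 * p.2 ^ (α.2 - 1)) • ContinuousLinearMap.snd ℂ ℂ ℂ) +
        p.2 ^ α.2 • ((α.1 * p.1 ^ (α.1 - 1)) • ContinuousLinearMap.fst ℂ ℂ ℂ)) p := by
  have d1 := (Complex.hasStrictDerivAt_cpow_const (c := α.1) h1).hasDerivAt.comp_hasFDerivAt p
    (hasFDerivAt_fst (𝕜 := ℂ) (E := ℂ) (F := ℂ))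
  have d2 := (Complex.hasStrictDerivAt_cpow_const (c := α.2) h2).hasDerivAt.comp_hasFDerivAt p
    (hasFDerivAt_snd (𝕜 := ℂ) (E := ℂ) (F := ℂ))
  exact d1.mul d2

/-- Off the branch cuts, a function that agrees with a multiple of a monomial is an eigenfunction
of `a θ₁ + b θ₂ + c`. -/
theorem lin2_eqOn_monomial (a b c K : ℂ) (α : ℂ × ℂ) {f : ℂ × ℂ → ℂ}
    (hf : Set.EqOn f (fun q => K * (q.1 ^ α.1 * q.2 ^ α.2))
      (Complex.slitPlane ×ˢ Complex.slitPlane)) :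
    Set.EqOn (lin2 a b c f) (fun q => (K * (a * α.1 + b * α.2 + c)) * (q.1 ^ α.1 * q.2 ^ α.2))
      (Complex.slitPlane ×ˢ Complex.slitPlane) := by
  intro p hp
  have hfp := hf hp
  have hfd : fderiv ℂ f p = _ :=
    (((hasFDerivAt_monomial α p hp.1 hp.2).const_mul K).congr_of_eventuallyEq
      (hf.eventuallyEq_of_mem
        ((Complex.isOpen_slitPlane.prod Complex.isOpen_slitPlane).mem_nhds hp))).fderiv
  have e1 : p.1 * p.1 ^ (α.1 - 1) = p.1 ^ α.1 := by
    rw [Complex.cpow_sub _ _ (Complex.slitPlane_ne_zero hp.1), Complex.cpow_one,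
      mul_div_cancel₀ _ (Complex.slitPlane_ne_zero hp.1)]
  have e2 : p.2 * p.2 ^ (α.2 - 1) = p.2 ^ α.2 := by
    rw [Complex.cpow_sub _ _ (Complex.slitPlane_ne_zero hp.2), Complex.cpow_one,
      mul_div_cancel₀ _ (Complex.slitPlane_ne_zero hp.2)]
  simp only [lin2, th1, th2, hfd, hfp]
  simp
  linear_combination a * K * α.1 * p.2 ^ α.2 * e1 + b * K * α.2 * p.1 ^ α.1 * e2

/-- Off the branch cuts, the product operator multiplies a monomial by the value of its symbol. -/
theorem linPow2_eqOn_monomial (a b c : ℂ) (α : ℂ × ℂ) (N : ℕ) :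
    Set.EqOn (linPow2 a b c N (fun q => q.1 ^ α.1 * q.2 ^ α.2))
      (fun q => (∏ ℓ ∈ Finset.range N, (a * α.1 + b * α.2 + c + ℓ)) * (q.1 ^ α.1 * q.2 ^ α.2))
      (Complex.slitPlane ×ˢ Complex.slitPlane) := by
  induction N with
  | zero => intro p _; simp [linPow2]
  | succ N ih =>
    simpa only [linPow2, Finset.prod_range_succ, add_assoc] using
      lin2_eqOn_monomial a b (c + N) _ α ih

/-- A product of consecutive shifts of `z` vanishes when `-z` is one of the shifts. -/
theorem prod_range_add_natCast_eq_zero {z : ℂ} {w : ℤ} {N : ℕ} (hw0 : 0 ≤ w) (hw : w < N)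
    (hz : z + w = 0) : ∏ ℓ ∈ Finset.range N, (z + ℓ) = 0 := by
  lift w to ℕ using hw0
  exact Finset.prod_eq_zero (Finset.mem_range.2 (by exact_mod_cast hw)) (by exact_mod_cast hz)

/-- Persistent monomial solutions of a bivariate atomic Horn system: if
`a₁α₁ + b₁α₂ + c̃₁ + u = 0` and `a₂α₁ + b₂α₂ + c̃₂ + v = 0` with
`0 ≤ u < min(a₁,b₁)` and `0 ≤ v < min(|a₂|,|b₂|)`, then the values
`P₁(α), P₂(α), Q₁(α), Q₂(α)` all vanish and the Puiseux monomial `x₁^{α₁} x₂^{α₂}`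
satisfies both equations of the atomic Horn system. -/
theorem stmt3 (a₁ b₁ a₂ b₂ : ℤ) (ha₁ : 0 < a₁) (hb₁ : 0 < b₁) (ha₂ : a₂ < 0) (hb₂ : b₂ < 0)
    (c₁ c₂ : ℂ) (u v : ℤ) (hu0 : 0 ≤ u) (hu : u < min a₁ b₁)
    (hv0 : 0 ≤ v) (hv : v < min |a₂| |b₂|)
    (α : ℂ × ℂ)
    (hα1 : (a₁ : ℂ) * α.1 + (b₁ : ℂ) * α.2 + c₁ + (u : ℂ) = 0)
    (hα2 : (a₂ : ℂ) * α.1 + (b₂ : ℂ) * α.2 + c₂ + (v : ℂ) = 0) :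
    (∏ ℓ ∈ Finset.range a₁.toNat, ((a₁ : ℂ) * α.1 + (b₁ : ℂ) * α.2 + c₁ + ℓ)) = 0 ∧
    (∏ ℓ ∈ Finset.range b₁.toNat, ((a₁ : ℂ) * α.1 + (b₁ : ℂ) * α.2 + c₁ + ℓ)) = 0 ∧
    (∏ ℓ ∈ Finset.range a₂.natAbs, ((a₂ : ℂ) * α.1 + (b₂ : ℂ) * α.2 + c₂ + ℓ)) = 0 ∧
    (∏ ℓ ∈ Finset.range b₂.natAbs, ((a₂ : ℂ) * α.1 + (b₂ : ℂ) * α.2 + c₂ + ℓ)) = 0 ∧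
    (∀ p : ℂ × ℂ, p.1 ∈ Complex.slitPlane → p.2 ∈ Complex.slitPlane →
      (p.1 * linPow2 (a₁ : ℂ) (b₁ : ℂ) c₁ a₁.toNat (fun q => q.1 ^ α.1 * q.2 ^ α.2) p
          = linPow2 (a₂ : ℂ) (b₂ : ℂ) c₂ a₂.natAbs (fun q => q.1 ^ α.1 * q.2 ^ α.2) p) ∧
      (p.2 * linPow2 (a₁ : ℂ) (b₁ : ℂ) c₁ b₁.toNat (fun q => q.1 ^ α.1 * q.2 ^ α.2) p
          = linPow2 (a₂ : ℂ) (b₂ : ℂ) c₂ b₂.natAbs (fun q => q.1 ^ α.1 * q.2 ^ α.2) p)) := by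
  rw [lt_min_iff] at hu hv
  rw [Int.abs_eq_natAbs, Int.abs_eq_natAbs] at hv
  have hP₁ := prod_range_add_natCast_eq_zero (N := a₁.toNat) hu0 (by omega) hα1
  have hP₂ := prod_range_add_natCast_eq_zero (N := b₁.toNat) hu0 (by omega) hα1
  have hQ₁ := prod_range_add_natCast_eq_zero (N := a₂.natAbs) hv0 (by omega) hα2
  have hQ₂ := prod_range_add_natCast_eq_zero (N := b₂.natAbs) hv0 (by omega) hα2
  refine ⟨hP₁, hP₂, hQ₁, hQ₂, fun p h1 h2 => ?_⟩
  have hp : p ∈ Complex.slitPlane ×ˢ Complex.slitPlane := ⟨h1, h2⟩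
  simp only [linPow2_eqOn_monomial _ _ _ α _ hp, hP₁, hP₂, hQ₁, hQ₂, zero_mul, mul_zero, and_self]
end

section
/- Let a_1, b_1 be positive integers, a_2, b_2 negative integers, c̃ ∈ ℂ², and let P_1, P_2, Q_1, Q_2 be the polynomials of the associated atomic Horn system. Let α ∈ ℂ², let k ≥ 1 be an integer, write e_2 = (0,1), and assume: P_2(α) = 0; Q_2(α − j e_2) ≠ 0 for 0 ≤ j ≤ k−1 and Q_2(α − k e_2) = 0; P_2(α − j e_2) ≠ 0 for 1 ≤ j ≤ k; and P_1(α − j e_2) = 0 and Q_1(α − j e_2) = 0 for all 0 ≤ j ≤ k. Then the Puiseux polynomial p(x) = Σ_{j=0}^{k} λ_j x_1^{α_1} x_2^{α_2 − j}, with λ_0 = 1 and λ_j = (∏_{i=0}^{j−1} Q_2(α − i e_2)) / (∏_{i=1}^{j} P_2(α − i e_2)) for 1 ≤ j ≤ k, satisfies both equations x_1 P_1(θ)p = Q_1(θ)p and x_2 P_2(θ)p = Q_2(θ)p on (ℂ∖(−∞,0])² (principal branches). (Persistent polynomial solutions of a bivariate atomic Horn system with support a segment in the e_2-direction.) -/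
open scoped BigOperators

/-- The value of `P₁(s) = ∏_{ℓ=0}^{a₁-1} (a₁s₁ + b₁s₂ + c̃₁ + ℓ)`. -/
noncomputable def P1v (a₁ b₁ : ℤ) (c₁ : ℂ) (s : ℂ × ℂ) : ℂ :=
  ∏ ℓ ∈ Finset.range a₁.toNat, ((a₁ : ℂ) * s.1 + (b₁ : ℂ) * s.2 + c₁ + ℓ)

/-- The value of `P₂(s) = ∏_{ℓ=0}^{b₁-1} (a₁s₁ + b₁s₂ + c̃₁ + ℓ)`. -/
noncomputable def P2v (a₁ b₁ : ℤ) (c₁ : ℂ) (s : ℂ × ℂ) : ℂ :=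
  ∏ ℓ ∈ Finset.range b₁.toNat, ((a₁ : ℂ) * s.1 + (b₁ : ℂ) * s.2 + c₁ + ℓ)

/-- The value of `Q₁(s) = ∏_{ℓ=0}^{|a₂|-1} (a₂s₁ + b₂s₂ + c̃₂ + ℓ)`. -/
noncomputable def Q1v (a₂ b₂ : ℤ) (c₂ : ℂ) (s : ℂ × ℂ) : ℂ :=
  ∏ ℓ ∈ Finset.range a₂.natAbs, ((a₂ : ℂ) * s.1 + (b₂ : ℂ) * s.2 + c₂ + ℓ)

/-- The value of `Q₂(s) = ∏_{ℓ=0}^{|b₂|-1} (a₂s₁ + b₂s₂ + c̃₂ + ℓ)`. -/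
noncomputable def Q2v (a₂ b₂ : ℤ) (c₂ : ℂ) (s : ℂ × ℂ) : ℂ :=
  ∏ ℓ ∈ Finset.range b₂.natAbs, ((a₂ : ℂ) * s.1 + (b₂ : ℂ) * s.2 + c₂ + ℓ)

/-- The Puiseux polynomial `p(x) = Σ_{j=0}^{k} λ_j x₁^{α₁} x₂^{α₂ - j}` with `λ₀ = 1` and
`λ_j = (∏_{i=0}^{j-1} Q₂(α - i e₂)) / (∏_{i=1}^{j} P₂(α - i e₂))`. -/
noncomputable def psol (a₁ b₁ a₂ b₂ : ℤ) (c₁ c₂ : ℂ) (α : ℂ × ℂ) (k : ℕ) : ℂ × ℂ → ℂ :=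
  fun x => ∑ j ∈ Finset.range (k + 1),
    ((∏ i ∈ Finset.range j, Q2v a₂ b₂ c₂ (α.1, α.2 - (i : ℂ))) /
        (∏ i ∈ Finset.range j, P2v a₁ b₁ c₁ (α.1, α.2 - ((i : ℂ) + 1)))) *
      (x.1 ^ α.1 * x.2 ^ (α.2 - (j : ℂ)))

/-- The finite Puiseux sum `∑ j ∈ s, λ_j x₁^{μ_j} x₂^{ν_j}`. -/
noncomputable def puiseuxSum {ι : Type*} (s : Finset ι) (lam μ ν : ι → ℂ) : ℂ × ℂ → ℂ :=
  fun x => ∑ j ∈ s, lam j * (x.1 ^ μ j * x.2 ^ ν j)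

theorem hasFDerivAt_puiseuxSum {ι : Type*} (s : Finset ι) (lam μ ν : ι → ℂ) {p : ℂ × ℂ}
    (h₁ : p.1 ∈ Complex.slitPlane) (h₂ : p.2 ∈ Complex.slitPlane) :
    HasFDerivAt (puiseuxSum s lam μ ν)
      (∑ j ∈ s, lam j •
        (p.1 ^ μ j • (ν j * p.2 ^ (ν j - 1)) • ContinuousLinearMap.snd ℂ ℂ ℂ +
          p.2 ^ ν j • (μ j * p.1 ^ (μ j - 1)) • ContinuousLinearMap.fst ℂ ℂ ℂ)) p := by
  refine HasFDerivAt.fun_sum fun j _ => HasFDerivAt.const_mul (HasFDerivAt.mul ?_ ?_) _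
  · exact (Complex.hasStrictDerivAt_cpow_const h₁).hasDerivAt.comp_hasFDerivAt p hasFDerivAt_fst
  · exact (Complex.hasStrictDerivAt_cpow_const h₂).hasDerivAt.comp_hasFDerivAt p hasFDerivAt_snd

theorem th1_puiseuxSum {ι : Type*} (s : Finset ι) (lam μ ν : ι → ℂ) {p : ℂ × ℂ}
    (h₁ : p.1 ∈ Complex.slitPlane) (h₂ : p.2 ∈ Complex.slitPlane) :
    th1 (puiseuxSum s lam μ ν) p = puiseuxSum s (fun j => μ j * lam j) μ ν p := by
  have h0 := Complex.slitPlane_ne_zero h₁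
  simp only [th1, (hasFDerivAt_puiseuxSum s lam μ ν h₁ h₂).fderiv, puiseuxSum,
    sum_apply, Finset.mul_sum]
  refine Finset.sum_congr rfl fun j _ => ?_
  simp [Complex.cpow_sub _ _ h0]
  field_simp

theorem th2_puiseuxSum {ι : Type*} (s : Finset ι) (lam μ ν : ι → ℂ) {p : ℂ × ℂ}
    (h₁ : p.1 ∈ Complex.slitPlane) (h₂ : p.2 ∈ Complex.slitPlane) :
    th2 (puiseuxSum s lam μ ν) p = puiseuxSum s (fun j => ν j * lam j) μ ν p := by
  have h0 := Complex.slitPlane_ne_zero h₂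
  simp only [th2, (hasFDerivAt_puiseuxSum s lam μ ν h₁ h₂).fderiv, puiseuxSum,
    sum_apply, Finset.mul_sum]
  refine Finset.sum_congr rfl fun j _ => ?_
  simp [Complex.cpow_sub _ _ h0]
  field_simp

theorem lin2_puiseuxSum {ι : Type*} (s : Finset ι) (lam μ ν : ι → ℂ) (a b c : ℂ) {p : ℂ × ℂ}
    (h₁ : p.1 ∈ Complex.slitPlane) (h₂ : p.2 ∈ Complex.slitPlane) :
    lin2 a b c (puiseuxSum s lam μ ν) p =
      puiseuxSum s (fun j => lam j * (a * μ j + b * ν j + c)) μ ν p := by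
  simp only [lin2, th1_puiseuxSum s lam μ ν h₁ h₂, th2_puiseuxSum s lam μ ν h₁ h₂, puiseuxSum,
    Finset.mul_sum, ← Finset.sum_add_distrib]
  exact Finset.sum_congr rfl fun j _ => by ring

theorem lin2_congr_of_eventuallyEq {f g : ℂ × ℂ → ℂ} {p : ℂ × ℂ} (h : f =ᶠ[nhds p] g)
    (a b c : ℂ) : lin2 a b c f p = lin2 a b c g p := by
  simp only [lin2, th1, th2, h.fderiv_eq, h.eq_of_nhds]

theorem linPow2_puiseuxSum {ι : Type*} (s : Finset ι) (lam μ ν : ι → ℂ) (a b c : ℂ) (N : ℕ)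
    {p : ℂ × ℂ} (h₁ : p.1 ∈ Complex.slitPlane) (h₂ : p.2 ∈ Complex.slitPlane) :
    linPow2 a b c N (puiseuxSum s lam μ ν) p =
      puiseuxSum s
        (fun j => lam j * ∏ ℓ ∈ Finset.range N, (a * μ j + b * ν j + c + ℓ)) μ ν p := by
  induction N generalizing p with
  | zero => simp [linPow2]
  | succ N ih =>
    have hev : linPow2 a b c N (puiseuxSum s lam μ ν) =ᶠ[nhds p] puiseuxSum s
        (fun j => lam j * ∏ ℓ ∈ Finset.range N, (a * μ j + b * ν j + c + ℓ)) μ ν := by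
      filter_upwards [(Complex.isOpen_slitPlane.prod Complex.isOpen_slitPlane).mem_nhds
        ⟨h₁, h₂⟩] with q hq
      exact ih hq.1 hq.2
    simp only [linPow2, lin2_congr_of_eventuallyEq hev, lin2_puiseuxSum _ _ _ _ _ _ _ h₁ h₂,
      Finset.prod_range_succ, mul_assoc, add_assoc]

/-- Persistent polynomial solutions of a bivariate atomic Horn system whose support is a
segment in the `e₂`-direction. -/
theorem stmt4 (a₁ b₁ a₂ b₂ : ℤ) (ha₁ : 0 < a₁) (hb₁ : 0 < b₁) (ha₂ : a₂ < 0) (hb₂ : b₂ < 0)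
    (c₁ c₂ : ℂ) (α : ℂ × ℂ) (k : ℕ) (hk : 1 ≤ k)
    (hP2α : P2v a₁ b₁ c₁ α = 0)
    (hQ2ne : ∀ j : ℕ, j < k → Q2v a₂ b₂ c₂ (α.1, α.2 - (j : ℂ)) ≠ 0)
    (hQ2k : Q2v a₂ b₂ c₂ (α.1, α.2 - (k : ℂ)) = 0)
    (hP2ne : ∀ j : ℕ, 1 ≤ j → j ≤ k → P2v a₁ b₁ c₁ (α.1, α.2 - (j : ℂ)) ≠ 0)
    (hP1 : ∀ j : ℕ, j ≤ k → P1v a₁ b₁ c₁ (α.1, α.2 - (j : ℂ)) = 0)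
    (hQ1 : ∀ j : ℕ, j ≤ k → Q1v a₂ b₂ c₂ (α.1, α.2 - (j : ℂ)) = 0) :
    ∀ p : ℂ × ℂ, p.1 ∈ Complex.slitPlane → p.2 ∈ Complex.slitPlane →
      (p.1 * linPow2 (a₁ : ℂ) (b₁ : ℂ) c₁ a₁.toNat (psol a₁ b₁ a₂ b₂ c₁ c₂ α k) p
          = linPow2 (a₂ : ℂ) (b₂ : ℂ) c₂ a₂.natAbs (psol a₁ b₁ a₂ b₂ c₁ c₂ α k) p) ∧
      (p.2 * linPow2 (a₁ : ℂ) (b₁ : ℂ) c₁ b₁.toNat (psol a₁ b₁ a₂ b₂ c₁ c₂ α k) p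
          = linPow2 (a₂ : ℂ) (b₂ : ℂ) c₂ b₂.natAbs (psol a₁ b₁ a₂ b₂ c₁ c₂ α k) p) := by
  rintro p h₁ h₂
  have h0 := Complex.slitPlane_ne_zero h₂
  have hp : psol a₁ b₁ a₂ b₂ c₁ c₂ α k = puiseuxSum (Finset.range (k + 1))
      (fun j => (∏ i ∈ Finset.range j, Q2v a₂ b₂ c₂ (α.1, α.2 - (i : ℂ))) /
        (∏ i ∈ Finset.range j, P2v a₁ b₁ c₁ (α.1, α.2 - ((i : ℂ) + 1))))
      (fun _ => α.1) (fun j => α.2 - (j : ℂ)) := rfl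
  simp only [hp, linPow2_puiseuxSum _ _ _ _ _ _ _ _ h₁ h₂]
  refine ⟨?_, ?_⟩
  · rw [puiseuxSum, puiseuxSum, Finset.sum_eq_zero, Finset.sum_eq_zero, mul_zero]
    · intro j hj
      have := hQ1 j (Finset.mem_range_succ_iff.1 hj)
      simp only [Q1v] at this
      simp [this]
    · intro j hj
      have := hP1 j (Finset.mem_range_succ_iff.1 hj)
      simp only [P1v] at this
      simp [this]
  · rw [puiseuxSum, puiseuxSum, Finset.sum_range_succ', Finset.sum_range_succ]
    have hP0 := hP2α
    simp only [P2v] at hP0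
    have hQk := hQ2k
    simp only [Q2v] at hQk
    simp only [Nat.cast_zero, sub_zero, hP0, hQk, mul_zero, zero_mul, add_zero, Finset.mul_sum]
    refine Finset.sum_congr rfl fun j hj => ?_
    have hne : P2v a₁ b₁ c₁ (α.1, α.2 - ((j : ℂ) + 1)) ≠ 0 := by
      simpa using hP2ne (j + 1) (by omega) (Finset.mem_range.1 hj)
    have hpow : p.2 ^ (α.2 - (j : ℂ)) = p.2 * p.2 ^ (α.2 - ((j : ℂ) + 1)) := by
      rw [← sub_sub, Complex.cpow_sub _ 1 h0, Complex.cpow_one, mul_div_cancel₀ _ h0]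
    rw [Finset.prod_range_succ, Finset.prod_range_succ, hpow, mul_div_mul_comm, Nat.cast_succ]
    change p.2 * (_ * (_ / _) * P2v a₁ b₁ c₁ (α.1, α.2 - ((j : ℂ) + 1)) * _) =
      _ * Q2v a₂ b₂ c₂ (α.1, α.2 - (j : ℂ)) * _
    rw [mul_assoc _ (_ / _), div_mul_cancel₀ _ hne]
    ring
end

section
/- Let M be an invertible n×n integer matrix with rows M_1,…,M_n, let α, β ∈ ℂⁿ, let M̃ be the 2n×n integer matrix with rows M_1,…,M_n, −M_1,…,−M_n, and let α̃ = (α_1,…,α_n,β_1,…,β_n) ∈ ℂ^{2n}. For v ∈ ℂⁿ write x^v = ∏_{i=1}^n x_i^{v_i} (principal branches). Then on the open set U = {x ∈ (ℂ∖(−∞,0])ⁿ : 1 + x^{−M^{−1}e_j} ∉ (−∞,0] for all j = 1,…,n} the function f(x) = x^{−M^{−1}α} · ∏_{j=1}^n (1 + x^{−M^{−1}e_j})^{−α_j − β_j} satisfies every equation of the parallelepipedal Horn system Horn(M̃, α̃), where e_j ∈ ℝⁿ is the j-th standard basis vector. (Solution formula for parallelepipedal hypergeometric configurations.) -/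
open scoped BigOperators

/-- The inverse of an integer matrix, viewed as a complex matrix. -/
noncomputable def Minv {n : ℕ} (M : Matrix (Fin n) (Fin n) ℤ) : Matrix (Fin n) (Fin n) ℂ :=
  (M.map (Int.cast : ℤ → ℂ))⁻¹

/-- `x^v = ∏ i, x_i^{v_i}` with principal branches. -/
noncomputable def xpow {n : ℕ} (x : Fin n → ℂ) (v : Fin n → ℂ) : ℂ := ∏ i, x i ^ v i

open Complex Filter Topology

/-- `f` is differentiable at `x` and `⟨a, θ⟩ f = d · f` at `x`. -/
def HasLogTheta {n : ℕ} (a : Fin n → ℤ) (f : (Fin n → ℂ) → ℂ) (x : Fin n → ℂ) (d : ℂ) : Prop :=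
  ∃ f' : (Fin n → ℂ) →L[ℂ] ℂ, HasFDerivAt f f' x ∧ f' (fun k => (a k : ℂ) * x k) = d * f x

namespace HasLogTheta

variable {n : ℕ} {a : Fin n → ℤ} {f g : (Fin n → ℂ) → ℂ} {x : Fin n → ℂ} {d e : ℂ}

theorem linFactor_eq (h : HasLogTheta a f x d) (c : ℂ) : linFactor a c f x = (d + c) * f x := by
  obtain ⟨f', hf, hd⟩ := h
  have hsum : ∑ k, (a k : ℂ) * th k f x = f' (fun k => (a k : ℂ) * x k) := by
    conv_rhs => rw [pi_eq_sum_univ' (fun k => (a k : ℂ) * x k)]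
    rw [map_sum]
    refine Finset.sum_congr rfl fun k _ => ?_
    rw [map_smul, th, hf.fderiv, smul_eq_mul]
    simp only [mul_assoc]
  rw [linFactor, hsum, hd]
  ring

theorem congr_val (h : HasLogTheta a f x d) (hde : d = e) : HasLogTheta a f x e := hde ▸ h

theorem const (a : Fin n → ℤ) (x : Fin n → ℂ) (c : ℂ) : HasLogTheta a (fun _ => c) x 0 :=
  ⟨0, hasFDerivAt_const c x, by simp⟩

theorem mul (hf : HasLogTheta a f x d) (hg : HasLogTheta a g x e) :
    HasLogTheta a (fun x => f x * g x) x (d + e) := by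
  obtain ⟨f', hf, hd⟩ := hf
  obtain ⟨g', hg, he⟩ := hg
  refine ⟨_, hf.mul hg, ?_⟩
  simp only [add_apply, smul_apply, smul_eq_mul, hd, he]
  ring

theorem const_mul (hf : HasLogTheta a f x d) (c : ℂ) : HasLogTheta a (fun x => c * f x) x d :=
  ((const a x c).mul hf).congr_val (zero_add d)

theorem finset_prod {ι : Type*} (s : Finset ι) {F : ι → (Fin n → ℂ) → ℂ} {D : ι → ℂ}
    (h : ∀ i ∈ s, HasLogTheta a (F i) x (D i)) :
    HasLogTheta a (fun x => ∏ i ∈ s, F i x) x (∑ i ∈ s, D i) := by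
  classical
  induction s using Finset.induction_on with
  | empty => simpa using const a x 1
  | insert i s hi ih =>
    simp only [Finset.prod_insert hi, Finset.sum_insert hi]
    exact (h i (Finset.mem_insert_self i s)).mul
      (ih fun j hj => h j (Finset.mem_insert_of_mem hj))

theorem list_prod {ι : Type*} (L : List ι) {F : ι → (Fin n → ℂ) → ℂ}
    (h : ∀ i ∈ L, HasLogTheta a (F i) x 0) :
    HasLogTheta a (fun x => (L.map fun i => F i x).prod) x 0 := by
  induction L with
  | nil => simpa using const a x 1
  | cons i L ih =>
    simp only [List.map_cons, List.prod_cons]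
    exact ((h i List.mem_cons_self).mul
      (ih fun j hj => h j (List.mem_cons_of_mem i hj))).congr_val (zero_add 0)

theorem pow (hf : HasLogTheta a f x d) (N : ℕ) : HasLogTheta a (fun x => f x ^ N) x (N * d) := by
  simpa using finset_prod (Finset.range N) fun _ _ => hf

theorem inv (hf : HasLogTheta a f x d) (h0 : f x ≠ 0) :
    HasLogTheta a (fun x => (f x)⁻¹) x (-d) := by
  obtain ⟨f', hf, hd⟩ := hf
  refine ⟨_, (hasDerivAt_inv h0).comp_hasFDerivAt x hf, ?_⟩
  simp only [smul_apply, smul_eq_mul, hd]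
  field_simp

theorem one_add (hf : HasLogTheta a f x d) (h0 : 1 + f x ≠ 0) :
    HasLogTheta a (fun x => 1 + f x) x (d * (f x / (1 + f x))) := by
  obtain ⟨f', hf, hd⟩ := hf
  refine ⟨f', hf.const_add 1, ?_⟩
  rw [hd]
  field_simp

theorem cpow_const (hf : HasLogTheta a f x d) (h0 : f x ∈ slitPlane) (c : ℂ) :
    HasLogTheta a (fun x => f x ^ c) x (c * d) := by
  obtain ⟨f', hf, hd⟩ := hf
  refine ⟨_, ((hasDerivAt_id (f x)).cpow_const (c := c) h0).comp_hasFDerivAt x hf, ?_⟩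
  have h1 := slitPlane_ne_zero h0
  simp only [smul_apply, smul_eq_mul, hd, id, cpow_sub _ _ h1, cpow_one]
  field_simp

theorem neg_row (hf : HasLogTheta a f x d) : HasLogTheta (fun k => -a k) f x (-d) := by
  obtain ⟨f', hf, hd⟩ := hf
  refine ⟨f', hf, ?_⟩
  have : (fun k => ((-a k : ℤ) : ℂ) * x k) = -fun k => (a k : ℂ) * x k := by
    ext k
    simp
  rw [this, map_neg, hd, neg_mul]

theorem coord (a : Fin n → ℤ) (x : Fin n → ℂ) (i : Fin n) :
    HasLogTheta a (fun x => x i) x (a i) :=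
  ⟨_, hasFDerivAt_apply i x, rfl⟩

theorem xpow (a : Fin n → ℤ) (hx : ∀ i, x i ∈ slitPlane) (w : Fin n → ℂ) :
    HasLogTheta a (fun x => xpow x w) x (∑ i, w i * a i) :=
  finset_prod Finset.univ fun i _ => (coord a x i).cpow_const (hx i) (w i)

theorem continuousAt (hf : HasLogTheta a f x d) : ContinuousAt f x := by
  obtain ⟨f', hf, -⟩ := hf
  exact hf.continuousAt

end HasLogTheta

section Locality

variable {n : ℕ} {U : Set (Fin n → ℂ)} {f g : (Fin n → ℂ) → ℂ}

theorem linFactor_congr (hU : IsOpen U) (h : Set.EqOn f g U) (a : Fin n → ℤ) (c : ℂ) :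
    Set.EqOn (linFactor a c f) (linFactor a c g) U := by
  intro x hx
  have he : f =ᶠ[𝓝 x] g := h.eventuallyEq_of_mem (hU.mem_nhds hx)
  simp only [linFactor, th, he.fderiv_eq, he.eq_of_nhds]

theorem factorPow_congr (hU : IsOpen U) (h : Set.EqOn f g U) (a : Fin n → ℤ) (c : ℂ) (N : ℕ) :
    Set.EqOn (factorPow a c N f) (factorPow a c N g) U := by
  induction N with
  | zero => exact h
  | succ N ih => exact linFactor_congr hU ih a _

/-- If multiplying `F` by powers of `r` shifts the eigenvalue of `⟨a, θ⟩ + c` suitably, the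
product `∏ (⟨a, θ⟩ + c + ℓ)` acts on `F` as multiplication by a multiple of a power of `r`. -/
theorem factorPow_eq (hU : IsOpen U) {F r : (Fin n → ℂ) → ℂ} {a : Fin n → ℤ} {c b : ℂ}
    {d e : (Fin n → ℂ) → ℂ} (hF : ∀ x ∈ U, HasLogTheta a F x (d x))
    (hr : ∀ x ∈ U, HasLogTheta a r x (e x))
    (hd : ∀ x ∈ U, d x + c = b * r x) (he : ∀ x ∈ U, e x + 1 = r x) (N : ℕ) :
    Set.EqOn (factorPow a c N F)
      (fun x => (∏ l ∈ Finset.range N, (b + l)) * r x ^ N * F x) U := by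
  induction N with
  | zero => intro x _; simp [factorPow]
  | succ N ih =>
    intro x hx
    refine (linFactor_congr hU ih a _ hx).trans ?_
    rw [((((hr x hx).pow N).const_mul _).mul (hF x hx)).linFactor_eq, Finset.prod_range_succ]
    have h : N * e x + d x + (c + N) = (b + N) * r x := by
      linear_combination hd x hx + N * he x hx
    rw [h]
    ring

end Locality

section Parallelepipedal

variable {n : ℕ}

theorem sub_lt_of_fin_two_mul (i : Fin (2 * n)) (h : ¬(i : ℕ) < n) : (i : ℕ) - n < n := by
  omega

/-- The rows `M_1, …, M_n, -M_1, …, -M_n`. -/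
def parRows (M : Matrix (Fin n) (Fin n) ℤ) (i : Fin (2 * n)) (k : Fin n) : ℤ :=
  if h : (i : ℕ) < n then M ⟨i, h⟩ k
  else -(M ⟨(i : ℕ) - n, sub_lt_of_fin_two_mul i h⟩ k)

/-- The parameters `α_1, …, α_n, β_1, …, β_n`. -/
def parParam (α β : Fin n → ℂ) (i : Fin (2 * n)) : ℂ :=
  if h : (i : ℕ) < n then α ⟨i, h⟩ else β ⟨(i : ℕ) - n, sub_lt_of_fin_two_mul i h⟩

/-- The row of `M` underlying a row of the doubled matrix. -/
def parIdx (i : Fin (2 * n)) : Fin n :=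
  if h : (i : ℕ) < n then ⟨i, h⟩ else ⟨(i : ℕ) - n, sub_lt_of_fin_two_mul i h⟩

/-- The monomial `x^{-M⁻¹ e_j}`. -/
noncomputable def parMono (M : Matrix (Fin n) (Fin n) ℤ) (j : Fin n) (x : Fin n → ℂ) : ℂ :=
  xpow x fun i => -(Minv M i j)

/-- The domain of the parallelepipedal solution. -/
def parDomain (M : Matrix (Fin n) (Fin n) ℤ) : Set (Fin n → ℂ) :=
  {x | (∀ i, x i ∈ slitPlane) ∧ ∀ j, 1 + parMono M j x ∈ slitPlane}

/-- The parallelepipedal solution. -/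
noncomputable def parSol (M : Matrix (Fin n) (Fin n) ℤ) (α β : Fin n → ℂ) (x : Fin n → ℂ) : ℂ :=
  xpow x (fun i => -((Minv M).mulVec α i)) * ∏ j, (1 + parMono M j x) ^ (-(α j) - β j)

/-- The ratio whose powers describe the action of a row of the doubled matrix. -/
noncomputable def parRatio (M : Matrix (Fin n) (Fin n) ℤ) (i : Fin (2 * n)) (x : Fin n → ℂ) : ℂ :=
  (if (i : ℕ) < n then parMono M (parIdx i) x else 1) * (1 + parMono M (parIdx i) x)⁻¹

/-- The multiplier by which `N` factors of a row of the doubled matrix act on the solution. -/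
noncomputable def parMult (M : Matrix (Fin n) (Fin n) ℤ) (α β : Fin n → ℂ) (i : Fin (2 * n))
    (N : ℕ) (x : Fin n → ℂ) : ℂ :=
  (∏ l ∈ Finset.range N, (α (parIdx i) + β (parIdx i) + l)) * parRatio M i x ^ N

variable {M : Matrix (Fin n) (Fin n) ℤ}

theorem mul_Minv (hM : M.det ≠ 0) : M.map (Int.cast : ℤ → ℂ) * Minv M = 1 := by
  refine Matrix.mul_nonsing_inv _ ?_
  have h : (M.map (Int.cast : ℤ → ℂ)).det = (M.det : ℂ) := ((Int.castRingHom ℂ).map_det M).symm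
  rw [h, isUnit_iff_ne_zero]
  exact_mod_cast hM

theorem Minv_mul (hM : M.det ≠ 0) : Minv M * M.map (Int.cast : ℤ → ℂ) = 1 :=
  mul_eq_one_comm.mp (mul_Minv hM)

theorem hasLogTheta_parMono (hM : M.det ≠ 0) {x : Fin n → ℂ} (hx : x ∈ parDomain M)
    (l j : Fin n) : HasLogTheta (M l) (parMono M j) x (if l = j then -1 else 0) := by
  refine (HasLogTheta.xpow (M l) hx.1 _).congr_val ?_
  have h := congrFun (congrFun (mul_Minv hM) l) j
  rw [Matrix.mul_apply, Matrix.one_apply] at h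
  simp only [Matrix.map_apply] at h
  have h2 : ∑ i, -(Minv M i j) * (M l i : ℂ) = -∑ i, (M l i : ℂ) * Minv M i j := by
    rw [← Finset.sum_neg_distrib]
    exact Finset.sum_congr rfl fun i _ => by ring
  rw [h2, h]
  split_ifs <;> simp

theorem isOpen_parDomain (hM : M.det ≠ 0) : IsOpen (parDomain M) := by
  rw [isOpen_iff_mem_nhds]
  intro x hx
  refine (eventually_all.mpr fun i => ?_).and (eventually_all.mpr fun j => ?_)
  · exact (continuous_apply i).continuousAt.eventually_mem (isOpen_slitPlane.mem_nhds (hx.1 i))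
  · exact (continuousAt_const.add (hasLogTheta_parMono hM hx j j).continuousAt).eventually_mem
      (isOpen_slitPlane.mem_nhds (hx.2 j))

theorem hasLogTheta_parSol (hM : M.det ≠ 0) (α β : Fin n → ℂ) {x : Fin n → ℂ}
    (hx : x ∈ parDomain M) (l : Fin n) :
    HasLogTheta (M l) (parSol M α β) x
      (-α l + (α l + β l) * (parMono M l x / (1 + parMono M l x))) := by
  have h1 : ∑ i, -((Minv M).mulVec α i) * (M l i : ℂ) = -α l := by
    have h := congrFun (Matrix.mulVec_mulVec α (M.map (Int.cast : ℤ → ℂ)) (Minv M)) l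
    rw [mul_Minv hM, Matrix.one_mulVec] at h
    rw [← h, Matrix.mulVec, dotProduct, ← Finset.sum_neg_distrib]
    exact Finset.sum_congr rfl fun i _ => by simp only [Matrix.map_apply]; ring
  refine ((HasLogTheta.xpow (M l) hx.1 _).mul (HasLogTheta.finset_prod Finset.univ fun j _ =>
    ((hasLogTheta_parMono hM hx l j).one_add (slitPlane_ne_zero (hx.2 j))).cpow_const
      (hx.2 j) (-(α j) - β j))).congr_val ?_
  rw [h1, Finset.sum_eq_single l (fun j _ hj => by simp [hj.symm]) (by simp)]
  simp only [if_true]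
  ring

theorem hasLogTheta_parRatio (hM : M.det ≠ 0) {x : Fin n → ℂ} (hx : x ∈ parDomain M)
    (l : Fin n) (i : Fin (2 * n)) :
    HasLogTheta (M l) (parRatio M i) x (if l = parIdx i then
      (if (i : ℕ) < n then parRatio M i x - 1 else 1 - parRatio M i x) else 0) := by
  have h0 := slitPlane_ne_zero (hx.2 (parIdx i))
  have hy := hasLogTheta_parMono hM hx l (parIdx i)
  have hinv := (hy.one_add h0).inv h0
  by_cases hi : (i : ℕ) < n
  · have h : parRatio M i = fun x => parMono M (parIdx i) x * (1 + parMono M (parIdx i) x)⁻¹ := by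
      ext x; simp [parRatio, hi]
    rw [h]
    refine (hy.mul hinv).congr_val ?_
    split_ifs
    · ring
    · ring
  · have h : parRatio M i = fun x => (1 + parMono M (parIdx i) x)⁻¹ := by
      ext x; simp [parRatio, hi]
    rw [h]
    refine hinv.congr_val ?_
    split_ifs
    · field_simp; ring
    · ring

theorem hasLogTheta_parMult_of_ne (hM : M.det ≠ 0) (α β : Fin n → ℂ) {x : Fin n → ℂ}
    (hx : x ∈ parDomain M) {l : Fin n} {i : Fin (2 * n)} {N : ℕ} (h : l ≠ parIdx i ∨ N = 0) :
    HasLogTheta (M l) (parMult M α β i N) x 0 := by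
  refine (((hasLogTheta_parRatio hM hx l i).pow N).const_mul _).congr_val ?_
  rcases h with h | h <;> simp [h]

theorem factorPow_parRows (hM : M.det ≠ 0) (α β : Fin n → ℂ) (i : Fin (2 * n)) (N : ℕ)
    {F : (Fin n → ℂ) → ℂ}
    (hF : ∀ x ∈ parDomain M, HasLogTheta (M (parIdx i)) F x (-α (parIdx i) +
      (α (parIdx i) + β (parIdx i)) *
        (parMono M (parIdx i) x / (1 + parMono M (parIdx i) x)))) :
    Set.EqOn (factorPow (parRows M i) (parParam α β i) N F)
      (fun x => parMult M α β i N x * F x) (parDomain M) := by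
  have hr := fun x (hx : x ∈ parDomain M) => hasLogTheta_parRatio hM hx (parIdx i) i
  have h0 := fun x (hx : x ∈ parDomain M) => slitPlane_ne_zero (hx.2 (parIdx i))
  by_cases hi : (i : ℕ) < n
  · have hA : parRows M i = M (parIdx i) := by ext k; simp [parRows, parIdx, hi]
    have hc : parParam α β i = α (parIdx i) := by simp [parParam, parIdx, hi]
    rw [hA, hc]
    refine factorPow_eq (isOpen_parDomain hM) hF hr (fun x hx => ?_) (fun x hx => ?_) N
    · simp only [parRatio, hi, if_true]
      ring
    · simp [hi]
  · have hA : parRows M i = fun k => -M (parIdx i) k := by ext k; simp [parRows, parIdx, hi]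
    have hc : parParam α β i = β (parIdx i) := by simp [parParam, parIdx, hi]
    rw [hA, hc]
    refine factorPow_eq (isOpen_parDomain hM) (fun x hx => (hF x hx).neg_row)
      (fun x hx => (hr x hx).neg_row) (fun x hx => ?_) (fun x hx => ?_) N
    · have := h0 x hx
      simp only [parRatio, hi, if_false]
      field_simp
      ring
    · simp [hi]

theorem foldr_factorPow_parRows (hM : M.det ≠ 0) (α β : Fin n → ℂ) (N : Fin (2 * n) → ℕ)
    (hN : ∀ i i', i ≠ i' → parIdx i = parIdx i' → N i = 0 ∨ N i' = 0)
    (L : List (Fin (2 * n))) (hL : L.Nodup) :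
    Set.EqOn (L.foldr (fun i g => factorPow (parRows M i) (parParam α β i) (N i) g)
        (parSol M α β))
      (fun x => (L.map fun i => parMult M α β i (N i) x).prod * parSol M α β x)
      (parDomain M) := by
  induction L with
  | nil => intro x _; simp
  | cons i L ih =>
    obtain ⟨hiL, hL⟩ := List.nodup_cons.mp hL
    intro x hx
    rw [List.foldr_cons, factorPow_congr (isOpen_parDomain hM) (ih hL) _ _ _ hx]
    by_cases hi : N i = 0
    · simp [hi, factorPow, parMult]
    rw [factorPow_parRows hM α β i (N i) (fun x hx => ?_) hx]
    · simp only [List.map_cons, List.prod_cons, mul_assoc]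
    · refine ((HasLogTheta.list_prod L fun i' hi' => ?_).mul
        (hasLogTheta_parSol hM α β hx (parIdx i))).congr_val (zero_add _)
      refine hasLogTheta_parMult_of_ne hM α β hx ?_
      by_cases h : parIdx i = parIdx i'
      · exact Or.inr ((hN i i' (fun h => hiL (h ▸ hi')) h).resolve_left hi)
      · exact Or.inl h

theorem parRows_eq_neg_of_parIdx_eq {i i' : Fin (2 * n)} (hne : i ≠ i') (h : parIdx i = parIdx i')
    (k : Fin n) : parRows M i k = -parRows M i' k := by
  have hne' : (i : ℕ) ≠ i' := fun h => hne (Fin.ext h)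
  by_cases h1 : (i : ℕ) < n <;> by_cases h2 : (i' : ℕ) < n <;>
    simp only [parIdx, h1, h2, dif_pos, not_false_eq_true, dif_neg, Fin.mk.injEq] at h
  · omega
  · rw [parRows, parRows, dif_pos h1, dif_neg h2, neg_neg]
    simp only [h]
  · simp only [parRows, h1, h2, dif_pos, not_false_eq_true, dif_neg, h]
  · omega

theorem Pop_parSol (hM : M.det ≠ 0) (α β : Fin n → ℂ) (k : Fin n) {x : Fin n → ℂ}
    (hx : x ∈ parDomain M) :
    Pop (parRows M) (parParam α β) k (parSol M α β) x =
      (∏ i, parMult M α β i (parRows M i k).toNat x) * parSol M α β x := by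
  have h : Pop (parRows M) (parParam α β) k (parSol M α β) = (List.finRange (2 * n)).foldr
      (fun i g => factorPow (parRows M i) (parParam α β i) (parRows M i k).toNat g)
      (parSol M α β) := by
    rw [Pop]
    congr 1
    ext i g x
    split_ifs with h
    · rfl
    · rw [Int.toNat_of_nonpos (not_lt.mp h)]; rfl
  rw [h, foldr_factorPow_parRows hM α β _ (fun i i' hne h => ?_) _ (List.nodup_finRange _) hx,
    Fin.prod_univ_def]
  have := parRows_eq_neg_of_parIdx_eq (M := M) hne h k
  omega

theorem Qop_parSol (hM : M.det ≠ 0) (α β : Fin n → ℂ) (k : Fin n) {x : Fin n → ℂ}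
    (hx : x ∈ parDomain M) :
    Qop (parRows M) (parParam α β) k (parSol M α β) x =
      (∏ i, parMult M α β i (-parRows M i k).toNat x) * parSol M α β x := by
  have h : Qop (parRows M) (parParam α β) k (parSol M α β) = (List.finRange (2 * n)).foldr
      (fun i g => factorPow (parRows M i) (parParam α β i) (-parRows M i k).toNat g)
      (parSol M α β) := by
    rw [Qop]
    congr 1
    ext i g x
    split_ifs with h
    · rw [show (parRows M i k).natAbs = (-parRows M i k).toNat by omega]
    · rw [show (-parRows M i k).toNat = 0 by omega]; rfl
  rw [h, foldr_factorPow_parRows hM α β _ (fun i i' hne h => ?_) _ (List.nodup_finRange _) hx,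
    Fin.prod_univ_def]
  have := parRows_eq_neg_of_parIdx_eq (M := M) hne h k
  omega

theorem prod_fin_two_mul {R : Type*} [CommMonoid R] (F : Fin (2 * n) → R) :
    ∏ i, F i = ∏ j : Fin n, F ⟨j, by omega⟩ * F ⟨n + j, by omega⟩ := by
  rw [← (finCongr (two_mul n).symm).prod_comp, Fin.prod_univ_add, ← Finset.prod_mul_distrib]
  rfl

theorem xpow_ne_zero {x : Fin n → ℂ} (hx : ∀ i, x i ∈ slitPlane) (v : Fin n → ℂ) :
    xpow x v ≠ 0 :=
  Finset.prod_ne_zero_iff.mpr fun i _ => by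
    simp [cpow_eq_zero_iff, slitPlane_ne_zero (hx i)]

theorem mul_prod_parMono_zpow (hM : M.det ≠ 0) {x : Fin n → ℂ} (hx : ∀ i, x i ∈ slitPlane)
    (k : Fin n) : x k * ∏ j, parMono M j x ^ M j k = 1 := by
  have h0 := fun i => slitPlane_ne_zero (hx i)
  have h : ∏ j, parMono M j x ^ M j k = ∏ i, x i ^ (-(if i = k then 1 else 0) : ℂ) := by
    simp only [parMono, xpow, ← Finset.prod_zpow]
    rw [Finset.prod_comm]
    refine Finset.prod_congr rfl fun i _ => ?_
    have hs := congrFun (congrFun (Minv_mul hM) i) k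
    rw [Matrix.mul_apply, Matrix.one_apply] at hs
    simp only [Matrix.map_apply] at hs
    rw [← hs, ← Finset.sum_neg_distrib, Complex.cpow_def_of_ne_zero (h0 i), Finset.mul_sum,
      Complex.exp_sum]
    refine Finset.prod_congr rfl fun j _ => ?_
    rw [Complex.cpow_def_of_ne_zero (h0 i), ← Complex.exp_int_mul]
    ring_nf
  rw [h, Finset.prod_eq_single k (fun i _ hi => by simp [hi]) (by simp)]
  simp [cpow_neg, h0 k]

theorem parMult_pair {x : Fin n → ℂ} (hx : x ∈ parDomain M) (α β : Fin n → ℂ) (k j : Fin n)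
    {i i' : Fin (2 * n)} (hi : i = ⟨j, by omega⟩) (hi' : i' = ⟨n + j, by omega⟩) :
    parMult M α β i (parRows M i k).toNat x * parMult M α β i' (parRows M i' k).toNat x =
      parMono M j x ^ M j k * (parMult M α β i (-parRows M i k).toNat x *
        parMult M α β i' (-parRows M i' k).toNat x) := by
  have hj : parIdx i = j := by simp [parIdx, hi]
  have hj' : parIdx i' = j := by simp [parIdx, hi']
  have hr : parRows M i k = M j k := by simp [parRows, hi]
  have hr' : parRows M i' k = -M j k := by simp [parRows, hi']
  have hR : parRatio M i x = parMono M j x * (1 + parMono M j x)⁻¹ := by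
    rw [parRatio, hj]
    simp [hi]
  have hR' : parRatio M i' x = (1 + parMono M j x)⁻¹ := by
    rw [parRatio, hj']
    simp [hi']
  have hy : parMono M j x ≠ 0 := xpow_ne_zero hx.1 _
  have hz : parMono M j x ^ (M j k).toNat =
      parMono M j x ^ M j k * parMono M j x ^ (-M j k).toNat := by
    rw [← zpow_natCast, ← zpow_natCast, ← zpow_add₀ hy]
    congr 1
    omega
  simp only [parMult, hr, hr', hj, hj', hR, hR', neg_neg, mul_pow, hz]
  ring

end Parallelepipedal

/-- Solution formula for parallelepipedal hypergeometric configurations: the function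
`x^{-M⁻¹α} ∏_j (1 + x^{-M⁻¹ e_j})^{-α_j - β_j}` satisfies every equation of the
parallelepipedal Horn system `Horn(M̃, α̃)` on the indicated open set. -/
theorem stmt6 {n : ℕ} (M : Matrix (Fin n) (Fin n) ℤ) (hM : M.det ≠ 0)
    (α β : Fin n → ℂ) :
    HornSol
      -- the matrix M̃ with rows M_1, …, M_n, -M_1, …, -M_n
      (fun (i : Fin (2 * n)) (k : Fin n) =>
        if h : (i : ℕ) < n then M ⟨i, h⟩ k
        else -(M ⟨(i : ℕ) - n, by have := i.isLt; omega⟩ k))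
      -- the parameter vector α̃ = (α_1, …, α_n, β_1, …, β_n)
      (fun i : Fin (2 * n) =>
        if h : (i : ℕ) < n then α ⟨i, h⟩ else β ⟨(i : ℕ) - n, by have := i.isLt; omega⟩)
      -- the open set U
      {x : Fin n → ℂ | (∀ i, x i ∈ Complex.slitPlane) ∧
        ∀ j, (1 + xpow x (fun i => -(Minv M i j))) ∈ Complex.slitPlane}
      -- the solution f
      (fun x => xpow x (fun i => -((Minv M).mulVec α i)) *
        ∏ j, (1 + xpow x (fun i => -(Minv M i j))) ^ (-(α j) - β j)) := by
  change HornSol (parRows M) (parParam α β) (parDomain M) (parSol M α β)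
  intro k x hx
  rw [Pop_parSol hM α β k hx, Qop_parSol hM α β k hx, prod_fin_two_mul, prod_fin_two_mul,
    Finset.prod_congr rfl fun j _ => parMult_pair hx α β k j rfl rfl, Finset.prod_mul_distrib,
    ← mul_assoc, ← mul_assoc, mul_prod_parMono_zpow hM hx.1 k, one_mul]
end

section
/- For arbitrary c_1, c_2, c_3 ∈ ℂ, the function u(x_1,x_2) = x_1^{−c_1} x_2^{−c_2} (1 − x_1 − x_2)^{c_1 + c_2 − c_3} (principal branches) satisfies the two equations x_1(θ_1 + θ_2 + c_3)u = (θ_1 + c_1)u and x_2(θ_1 + θ_2 + c_3)u = (θ_2 + c_2)u on the open set {x ∈ ℂ² : x_1 ∉ (−∞,0], x_2 ∉ (−∞,0], 1 − x_1 − x_2 ∉ (−∞,0]}. (This is the solution of the unique bivariate Horn system of holonomic rank 1.) -/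
open scoped BigOperators

/-- A power with constant exponent, differentiated along the slit plane, in logarithmic form. -/
theorem HasFDerivAt.cpow_const_log {E : Type*} [NormedAddCommGroup E] [NormedSpace ℂ E]
    {f : E → ℂ} {f' : E →L[ℂ] ℂ} {p : E} (hf : HasFDerivAt f f' p)
    (hp : f p ∈ Complex.slitPlane) (c : ℂ) :
    HasFDerivAt (fun q => f q ^ c) ((f p ^ c * (c / f p)) • f') p := by
  have h := ((hasDerivAt_id (f p)).cpow_const (c := c) hp).comp_hasFDerivAt p hf
  have e : c * f p ^ (c - 1) * 1 = f p ^ c * (c / f p) := by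
    rw [Complex.cpow_sub _ _ (Complex.slitPlane_ne_zero hp), Complex.cpow_one]
    ring
  rw [← e]
  exact h

/-- The Fréchet derivative of `x₁ ^ a * x₂ ^ b * (1 - x₁ - x₂) ^ s`. -/
theorem fderiv_cpow_mul_cpow_mul_cpow (a b s : ℂ) {p : ℂ × ℂ} (h₁ : p.1 ∈ Complex.slitPlane)
    (h₂ : p.2 ∈ Complex.slitPlane) (h₃ : 1 - p.1 - p.2 ∈ Complex.slitPlane) (v : ℂ × ℂ) :
    fderiv ℂ (fun q : ℂ × ℂ => q.1 ^ a * q.2 ^ b * (1 - q.1 - q.2) ^ s) p v =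
      p.1 ^ a * p.2 ^ b * (1 - p.1 - p.2) ^ s *
        (a / p.1 * v.1 + b / p.2 * v.2 - s / (1 - p.1 - p.2) * (v.1 + v.2)) := by
  have d₁ : HasFDerivAt (fun q : ℂ × ℂ => q.1) (ContinuousLinearMap.fst ℂ ℂ ℂ) p :=
    hasFDerivAt_fst
  have d₂ : HasFDerivAt (fun q : ℂ × ℂ => q.2) (ContinuousLinearMap.snd ℂ ℂ ℂ) p :=
    hasFDerivAt_snd
  have d := ((d₁.cpow_const_log h₁ a).mul (d₂.cpow_const_log h₂ b)).mul
    (((d₁.const_sub 1).sub d₂).cpow_const_log h₃ s)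
  have e := congrArg (fun L : ℂ × ℂ →L[ℂ] ℂ => L v) d.fderiv
  refine e.trans ?_
  simp
  ring

/-- For arbitrary `c₁, c₂, c₃ ∈ ℂ`, the function
`u(x) = x₁^{-c₁} x₂^{-c₂} (1 - x₁ - x₂)^{c₁+c₂-c₃}` satisfies the equations
`x₁(θ₁+θ₂+c₃)u = (θ₁+c₁)u` and `x₂(θ₁+θ₂+c₃)u = (θ₂+c₂)u` — the unique bivariate Horn
system of holonomic rank 1. -/
theorem stmt7 (c₁ c₂ c₃ : ℂ) :
    ∀ p : ℂ × ℂ, p.1 ∈ Complex.slitPlane → p.2 ∈ Complex.slitPlane →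
      (1 - p.1 - p.2) ∈ Complex.slitPlane →
      (p.1 * lin2 1 1 c₃ (fun q => q.1 ^ (-c₁) * q.2 ^ (-c₂) * (1 - q.1 - q.2) ^ (c₁ + c₂ - c₃)) p
          = th1 (fun q => q.1 ^ (-c₁) * q.2 ^ (-c₂) * (1 - q.1 - q.2) ^ (c₁ + c₂ - c₃)) p
            + c₁ * (p.1 ^ (-c₁) * p.2 ^ (-c₂) * (1 - p.1 - p.2) ^ (c₁ + c₂ - c₃))) ∧
      (p.2 * lin2 1 1 c₃ (fun q => q.1 ^ (-c₁) * q.2 ^ (-c₂) * (1 - q.1 - q.2) ^ (c₁ + c₂ - c₃)) p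
          = th2 (fun q => q.1 ^ (-c₁) * q.2 ^ (-c₂) * (1 - q.1 - q.2) ^ (c₁ + c₂ - c₃)) p
            + c₂ * (p.1 ^ (-c₁) * p.2 ^ (-c₂) * (1 - p.1 - p.2) ^ (c₁ + c₂ - c₃))) := by
  intro p h₁ h₂ h₃
  have n₁ := Complex.slitPlane_ne_zero h₁
  have n₂ := Complex.slitPlane_ne_zero h₂
  have n₃ := Complex.slitPlane_ne_zero h₃
  simp only [lin2, th1, th2, fderiv_cpow_mul_cpow_mul_cpow _ _ _ h₁ h₂ h₃]
  generalize p.1 ^ (-c₁) * p.2 ^ (-c₂) * (1 - p.1 - p.2) ^ (c₁ + c₂ - c₃) = u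
  constructor
  · field_simp
    ring
  · field_simp
    ring
end

section
/- Let c ∈ ℂ and ε_1, ε_2 ∈ {1, −1}. The function f(x) = (1 + ε_1 x_1^{1/2} + ε_2 x_2^{1/2})^{−c} (principal branches) satisfies the two equations x_1(2θ_1 + 2θ_2 + c)(2θ_1 + 2θ_2 + c + 1)f = 2θ_1(2θ_1 − 1)f and x_2(2θ_1 + 2θ_2 + c)(2θ_1 + 2θ_2 + c + 1)f = 2θ_2(2θ_2 − 1)f on the open set {x ∈ ℂ² : x_1 ∉ (−∞,0], x_2 ∉ (−∞,0], 1 + ε_1 x_1^{1/2} + ε_2 x_2^{1/2} ∉ (−∞,0]}. (The four fully supported solutions of the simplicial Horn system defined by the matrix with rows (−2,0), (0,−2), (2,2) and parameters (0,0,c).) -/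
open scoped BigOperators

/-- The function `(1 + ε₁ x₁^{1/2} + ε₂ x₂^{1/2})^{-c}` (principal branches). -/
noncomputable def fsimp (ε₁ ε₂ c : ℂ) : ℂ × ℂ → ℂ :=
  fun q => (1 + ε₁ * q.1 ^ ((1 : ℂ) / 2) + ε₂ * q.2 ^ ((1 : ℂ) / 2)) ^ (-c)

/-- The function `1 + ε₁ x₁^{1/2} + ε₂ x₂^{1/2}`, of which `fsimp` is a power. -/
noncomputable def fsimpBase (ε₁ ε₂ : ℂ) : ℂ × ℂ → ℂ :=
  fun q => 1 + ε₁ * q.1 ^ ((1 : ℂ) / 2) + ε₂ * q.2 ^ ((1 : ℂ) / 2)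

/-- The domain on which all the principal branches in `fsimp` are holomorphic. -/
def fsimpDomain (ε₁ ε₂ : ℂ) : Set (ℂ × ℂ) :=
  {q | q.1 ∈ Complex.slitPlane ∧ q.2 ∈ Complex.slitPlane ∧ fsimpBase ε₁ ε₂ q ∈ Complex.slitPlane}

lemma th1_eq_of_hasFDerivAt {f : ℂ × ℂ → ℂ} {L : ℂ × ℂ →L[ℂ] ℂ} {p : ℂ × ℂ}
    (h : HasFDerivAt f L p) : th1 f p = p.1 * L (1, 0) := by
  rw [th1, h.fderiv]

lemma th2_eq_of_hasFDerivAt {f : ℂ × ℂ → ℂ} {L : ℂ × ℂ →L[ℂ] ℂ} {p : ℂ × ℂ}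
    (h : HasFDerivAt f L p) : th2 f p = p.2 * L (0, 1) := by
  rw [th2, h.fderiv]

lemma cpow_half_mul_self (z : ℂ) : z ^ ((1 : ℂ) / 2) * z ^ ((1 : ℂ) / 2) = z := by
  rw [← pow_two, one_div]
  exact Complex.cpow_nat_inv_pow z two_ne_zero

lemma hasDerivAt_cpow_half {z : ℂ} (hz : z ∈ Complex.slitPlane) :
    HasDerivAt (fun w : ℂ => w ^ ((1 : ℂ) / 2)) (z ^ ((1 : ℂ) / 2) / (2 * z)) z := by
  have h := (hasDerivAt_id z).cpow_const (c := (1 : ℂ) / 2) hz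
  refine h.congr_deriv ?_
  have hz0 := Complex.slitPlane_ne_zero hz
  simp only [id]
  rw [Complex.cpow_sub _ _ hz0, Complex.cpow_one]
  field_simp

lemma hasFDerivAt_cpow_half_fst {p : ℂ × ℂ} (h : p.1 ∈ Complex.slitPlane) :
    HasFDerivAt (fun q : ℂ × ℂ => q.1 ^ ((1 : ℂ) / 2))
      ((p.1 ^ ((1 : ℂ) / 2) / (2 * p.1)) • ContinuousLinearMap.fst ℂ ℂ ℂ) p :=
  (hasDerivAt_cpow_half h).comp_hasFDerivAt p hasFDerivAt_fst

lemma hasFDerivAt_cpow_half_snd {p : ℂ × ℂ} (h : p.2 ∈ Complex.slitPlane) :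
    HasFDerivAt (fun q : ℂ × ℂ => q.2 ^ ((1 : ℂ) / 2))
      ((p.2 ^ ((1 : ℂ) / 2) / (2 * p.2)) • ContinuousLinearMap.snd ℂ ℂ ℂ) p :=
  (hasDerivAt_cpow_half h).comp_hasFDerivAt p hasFDerivAt_snd

section

variable {ε₁ ε₂ : ℂ} {p : ℂ × ℂ}

lemma hasFDerivAt_fsimpBase (h₁ : p.1 ∈ Complex.slitPlane) (h₂ : p.2 ∈ Complex.slitPlane) :
    HasFDerivAt (fsimpBase ε₁ ε₂)
      (ε₁ • ((p.1 ^ ((1 : ℂ) / 2) / (2 * p.1)) • ContinuousLinearMap.fst ℂ ℂ ℂ) +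
        ε₂ • ((p.2 ^ ((1 : ℂ) / 2) / (2 * p.2)) • ContinuousLinearMap.snd ℂ ℂ ℂ)) p :=
  (((hasFDerivAt_cpow_half_fst h₁).const_mul ε₁).const_add 1).add
    ((hasFDerivAt_cpow_half_snd h₂).const_mul ε₂)

lemma eventually_mem_fsimpDomain (h : p ∈ fsimpDomain ε₁ ε₂) :
    ∀ᶠ q in nhds p, q ∈ fsimpDomain ε₁ ε₂ := by
  obtain ⟨h₁, h₂, h₃⟩ := h
  exact (continuousAt_fst.eventually_mem (Complex.isOpen_slitPlane.mem_nhds h₁)).and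
    ((continuousAt_snd.eventually_mem (Complex.isOpen_slitPlane.mem_nhds h₂)).and
      ((hasFDerivAt_fsimpBase h₁ h₂).continuousAt.eventually_mem
        (Complex.isOpen_slitPlane.mem_nhds h₃)))

lemma hasFDerivAt_fsimp (c : ℂ) (h : p ∈ fsimpDomain ε₁ ε₂) :
    HasFDerivAt (fsimp ε₁ ε₂ c)
      ((-c * fsimp ε₁ ε₂ (c + 1) p) •
        (ε₁ • ((p.1 ^ ((1 : ℂ) / 2) / (2 * p.1)) • ContinuousLinearMap.fst ℂ ℂ ℂ) +
          ε₂ • ((p.2 ^ ((1 : ℂ) / 2) / (2 * p.2)) • ContinuousLinearMap.snd ℂ ℂ ℂ))) p := by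
  have hg := ((hasDerivAt_id _).cpow_const (c := -c) h.2.2).comp_hasFDerivAt p
    (hasFDerivAt_fsimpBase h.1 h.2.1)
  refine hg.congr_fderiv ?_
  simp only [id, fsimp, mul_one, neg_add, sub_eq_add_neg]

lemma fsimp_eq_base_mul_fsimp_add_one (c : ℂ) (h : p ∈ fsimpDomain ε₁ ε₂) :
    fsimp ε₁ ε₂ c p = fsimpBase ε₁ ε₂ p * fsimp ε₁ ε₂ (c + 1) p := by
  have h0 := Complex.slitPlane_ne_zero h.2.2
  change fsimpBase ε₁ ε₂ p ^ (-c) = fsimpBase ε₁ ε₂ p * fsimpBase ε₁ ε₂ p ^ (-(c + 1))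
  rw [neg_add, ← sub_eq_add_neg, Complex.cpow_sub _ _ h0, Complex.cpow_one]
  field_simp

lemma th1_fsimp (c : ℂ) (h : p ∈ fsimpDomain ε₁ ε₂) :
    2 * th1 (fsimp ε₁ ε₂ c) p
      = -c * ε₁ * (p.1 ^ ((1 : ℂ) / 2) * fsimp ε₁ ε₂ (c + 1) p) := by
  have h0 := Complex.slitPlane_ne_zero h.1
  rw [th1_eq_of_hasFDerivAt (hasFDerivAt_fsimp c h)]
  simp
  field_simp

lemma th2_fsimp (c : ℂ) (h : p ∈ fsimpDomain ε₁ ε₂) :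
    2 * th2 (fsimp ε₁ ε₂ c) p
      = -c * ε₂ * (p.2 ^ ((1 : ℂ) / 2) * fsimp ε₁ ε₂ (c + 1) p) := by
  have h0 := Complex.slitPlane_ne_zero h.2.1
  rw [th2_eq_of_hasFDerivAt (hasFDerivAt_fsimp c h)]
  simp
  field_simp

lemma lin2_fsimp (a c : ℂ) (h : p ∈ fsimpDomain ε₁ ε₂) :
    lin2 2 2 a (fsimp ε₁ ε₂ c) p
      = (a - c) * fsimp ε₁ ε₂ c p + c * fsimp ε₁ ε₂ (c + 1) p := by
  rw [lin2, th1_fsimp c h, th2_fsimp c h, fsimp_eq_base_mul_fsimp_add_one c h, fsimpBase]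
  ring

lemma lin2_add_const_mul {f g : ℂ × ℂ → ℂ} (hf : DifferentiableAt ℂ f p)
    (hg : DifferentiableAt ℂ g p) (a b c k : ℂ) :
    lin2 a b c (fun q => f q + k * g q) p = lin2 a b c f p + k * lin2 a b c g p := by
  have h := hf.hasFDerivAt.add (hg.hasFDerivAt.const_mul k)
  have e : (fun q => f q + k * g q) = f + fun q => k * g q := rfl
  rw [e, lin2, th1_eq_of_hasFDerivAt h, th2_eq_of_hasFDerivAt h]
  simp [lin2, th1, th2]
  ring

lemma lin2_congr {f g : ℂ × ℂ → ℂ} (h : f =ᶠ[nhds p] g) (a b c : ℂ) :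
    lin2 a b c f p = lin2 a b c g p := by
  simp only [lin2, th1, th2, h.fderiv_eq, h.eq_of_nhds]

/-- Each application of `2θ₁ + 2θ₂ + c` and `2θ₁ + 2θ₂ + c + 1` raises the exponent by one. -/
lemma lin2_lin2_fsimp (c : ℂ) (h : p ∈ fsimpDomain ε₁ ε₂) :
    lin2 2 2 c (lin2 2 2 (c + 1) (fsimp ε₁ ε₂ c)) p
      = c * (c + 1) * fsimp ε₁ ε₂ (c + 1 + 1) p := by
  have e : lin2 2 2 (c + 1) (fsimp ε₁ ε₂ c) =ᶠ[nhds p]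
      fun q => fsimp ε₁ ε₂ c q + c * fsimp ε₁ ε₂ (c + 1) q := by
    filter_upwards [eventually_mem_fsimpDomain h] with q hq
    rw [lin2_fsimp _ _ hq]
    ring
  rw [lin2_congr e, lin2_add_const_mul (hasFDerivAt_fsimp c h).differentiableAt
    (hasFDerivAt_fsimp (c + 1) h).differentiableAt, lin2_fsimp _ _ h, lin2_fsimp _ _ h]
  ring

lemma th1_th1_fsimp (c : ℂ) (h : p ∈ fsimpDomain ε₁ ε₂) :
    2 * th1 (fun q => 2 * th1 (fsimp ε₁ ε₂ c) q - fsimp ε₁ ε₂ c q) p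
      = ε₁ ^ 2 * p.1 * (c * (c + 1) * fsimp ε₁ ε₂ (c + 1 + 1) p) := by
  have e : (fun q => 2 * th1 (fsimp ε₁ ε₂ c) q - fsimp ε₁ ε₂ c q) =ᶠ[nhds p]
      fun q => -c * ε₁ * (q.1 ^ ((1 : ℂ) / 2) * fsimp ε₁ ε₂ (c + 1) q) - fsimp ε₁ ε₂ c q := by
    filter_upwards [eventually_mem_fsimpDomain h] with q hq
    rw [th1_fsimp c hq]
  have hd := (((hasFDerivAt_cpow_half_fst h.1).mul
    (hasFDerivAt_fsimp (c + 1) h)).const_mul (-c * ε₁)).sub (hasFDerivAt_fsimp c h)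
  have h0 := Complex.slitPlane_ne_zero h.1
  rw [th1_eq_of_hasFDerivAt (hd.congr_of_eventuallyEq e)]
  have hs := cpow_half_mul_self p.1
  simp
  field_simp
  linear_combination (c * (c + 1) * ε₁ ^ 2 * fsimp ε₁ ε₂ (c + 1 + 1) p) * hs

lemma th2_th2_fsimp (c : ℂ) (h : p ∈ fsimpDomain ε₁ ε₂) :
    2 * th2 (fun q => 2 * th2 (fsimp ε₁ ε₂ c) q - fsimp ε₁ ε₂ c q) p
      = ε₂ ^ 2 * p.2 * (c * (c + 1) * fsimp ε₁ ε₂ (c + 1 + 1) p) := by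
  have e : (fun q => 2 * th2 (fsimp ε₁ ε₂ c) q - fsimp ε₁ ε₂ c q) =ᶠ[nhds p]
      fun q => -c * ε₂ * (q.2 ^ ((1 : ℂ) / 2) * fsimp ε₁ ε₂ (c + 1) q) - fsimp ε₁ ε₂ c q := by
    filter_upwards [eventually_mem_fsimpDomain h] with q hq
    rw [th2_fsimp c hq]
  have hd := (((hasFDerivAt_cpow_half_snd h.2.1).mul
    (hasFDerivAt_fsimp (c + 1) h)).const_mul (-c * ε₂)).sub (hasFDerivAt_fsimp c h)
  have h0 := Complex.slitPlane_ne_zero h.2.1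
  rw [th2_eq_of_hasFDerivAt (hd.congr_of_eventuallyEq e)]
  have hs := cpow_half_mul_self p.2
  simp
  field_simp
  linear_combination (c * (c + 1) * ε₂ ^ 2 * fsimp ε₁ ε₂ (c + 1 + 1) p) * hs

end

/-- The four fully supported solutions `(1 + ε₁√x₁ + ε₂√x₂)^{-c}` of the simplicial Horn
system defined by the matrix with rows `(-2,0), (0,-2), (2,2)` and parameters `(0,0,c)`:
`x₁(2θ₁+2θ₂+c)(2θ₁+2θ₂+c+1)f = 2θ₁(2θ₁-1)f` and
`x₂(2θ₁+2θ₂+c)(2θ₁+2θ₂+c+1)f = 2θ₂(2θ₂-1)f`. -/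
theorem stmt10 (c ε₁ ε₂ : ℂ) (hε₁ : ε₁ = 1 ∨ ε₁ = -1) (hε₂ : ε₂ = 1 ∨ ε₂ = -1) :
    ∀ p : ℂ × ℂ, p.1 ∈ Complex.slitPlane → p.2 ∈ Complex.slitPlane →
      (1 + ε₁ * p.1 ^ ((1 : ℂ) / 2) + ε₂ * p.2 ^ ((1 : ℂ) / 2)) ∈ Complex.slitPlane →
      (p.1 * lin2 2 2 c (lin2 2 2 (c + 1) (fsimp ε₁ ε₂ c)) p
          = 2 * th1 (fun q => 2 * th1 (fsimp ε₁ ε₂ c) q - fsimp ε₁ ε₂ c q) p) ∧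
      (p.2 * lin2 2 2 c (lin2 2 2 (c + 1) (fsimp ε₁ ε₂ c)) p
          = 2 * th2 (fun q => 2 * th2 (fsimp ε₁ ε₂ c) q - fsimp ε₁ ε₂ c q) p) := by
  intro p h₁ h₂ h₃
  have h : p ∈ fsimpDomain ε₁ ε₂ := ⟨h₁, h₂, h₃⟩
  have s₁ : ε₁ ^ 2 = 1 := by rcases hε₁ with rfl | rfl <;> norm_num
  have s₂ : ε₂ ^ 2 = 1 := by rcases hε₂ with rfl | rfl <;> norm_num
  rw [lin2_lin2_fsimp c h, th1_th1_fsimp c h, th2_th2_fsimp c h, s₁, s₂, one_mul, one_mul]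
  exact ⟨rfl, rfl⟩
end

section
/- Let U = {x ∈ ℂ² : x_1 ∉ (−∞,0], x_2 ∉ (−∞,0], and 1 + ε_1 x_1^{1/2} + ε_2 x_2^{1/2} ∉ (−∞,0] for all ε_1, ε_2 ∈ {1,−1}} (principal branches), a nonempty open subset of ℂ². For every c ∈ ℂ with c ≠ 0 and c ≠ −1, the four functions f̂_1 = (1+√x_1+√x_2)^{−c}, f̂_2 = ((1+√x_1+√x_2)^{−c} − (1+√x_1−√x_2)^{−c})/c, f̂_3 = ((1+√x_1+√x_2)^{−c} − (1−√x_1+√x_2)^{−c})/c, and f̂_4 = ((1+√x_1+√x_2)^{−c} − (1+√x_1−√x_2)^{−c} − (1−√x_1+√x_2)^{−c} + (1−√x_1−√x_2)^{−c})/(c + c²) are linearly independent over ℂ as functions on U. (The universal basis of the solution space of the simplicial Horn system defined by the matrix with rows (−2,0), (0,−2), (2,2).) -/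
/-- The domain `U`. -/
def U11 : Set (ℂ × ℂ) :=
  {p | p.1 ∈ Complex.slitPlane ∧ p.2 ∈ Complex.slitPlane ∧
    ∀ ε₁ ε₂ : ℂ, (ε₁ = 1 ∨ ε₁ = -1) → (ε₂ = 1 ∨ ε₂ = -1) →
      (1 + ε₁ * p.1 ^ ((1 : ℂ) / 2) + ε₂ * p.2 ^ ((1 : ℂ) / 2)) ∈ Complex.slitPlane}

/-- The vanishing, for small positive real `s` and `t`, of the combination of the four powers
`(1 ± s ± t) ^ k` with the given coefficients. -/
def PowRelation (a b g d k : ℂ) : Prop :=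
  ∀ s t : ℝ, s ∈ Set.Ioo (0 : ℝ) (1 / 4) → t ∈ Set.Ioo (0 : ℝ) (1 / 4) →
    a * (1 + s + t : ℂ) ^ k + b * (1 + s - t : ℂ) ^ k + g * (1 - s + t : ℂ) ^ k +
      d * (1 - s - t : ℂ) ^ k = 0

/-- Exchanging the two variables in a relation. -/
theorem PowRelation.swap {a b g d k : ℂ} (h : PowRelation a b g d k) :
    PowRelation a g b d k := by
  intro s t hs ht
  have := h t s ht hs
  rw [show (1 + t + s : ℂ) = 1 + s + t by ring, show (1 + t - s : ℂ) = 1 - s + t by ring,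
    show (1 - t + s : ℂ) = 1 + s - t by ring, show (1 - t - s : ℂ) = 1 - s - t by ring] at this
  linear_combination this

/-- Differentiating a relation with respect to the first variable. -/
theorem PowRelation.deriv {a b g d k : ℂ} (hk : k ≠ 0) (h : PowRelation a b g d k) :
    PowRelation a b (-g) (-d) (k - 1) := by
  intro s t hs ht
  have key : ∀ e u : ℂ, 0 < (1 + e * s + u).re →
      HasDerivAt (fun z : ℂ => (1 + e * z + u) ^ k) (k * (1 + e * s + u) ^ (k - 1) * e) s := by
    intro e u hre
    have h1 : HasDerivAt (fun z : ℂ => 1 + e * z + u) e s := by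
      simpa using (((hasDerivAt_id (s : ℂ)).const_mul e).const_add 1).add_const u
    exact h1.cpow_const (Or.inl hre)
  obtain ⟨hs0, hs1⟩ := hs
  obtain ⟨ht0, ht1⟩ := ht
  have hA := key 1 t (by simp; linarith)
  have hB := key 1 (-t) (by simp; linarith)
  have hG := key (-1) t (by simp; linarith)
  have hD := key (-1) (-t) (by simp; linarith)
  have hsum := ((((hA.const_mul a).add (hB.const_mul b)).add (hG.const_mul g)).add
    (hD.const_mul d)).comp_ofReal
  have hzero := (hasDerivAt_const s (0 : ℂ)).congr_of_eventuallyEq (f₁ := fun y : ℝ =>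
      a * (1 + 1 * (y : ℂ) + t) ^ k + b * (1 + 1 * (y : ℂ) + -t) ^ k +
        g * (1 + -1 * (y : ℂ) + t) ^ k + d * (1 + -1 * (y : ℂ) + -t) ^ k) (by
    filter_upwards [Ioo_mem_nhds hs0 hs1] with y hy
    simpa [← sub_eq_add_neg] using h y t hy ⟨ht0, ht1⟩)
  have heq := hsum.unique hzero
  simp only [one_mul, neg_mul, ← sub_eq_add_neg] at heq
  refine mul_left_cancel₀ hk ?_
  linear_combination heq

/-- Outside the exponents `0` and `1`, there are only trivial relations. -/
theorem PowRelation.eq_zero {a b g d k : ℂ} (hk : k ≠ 0) (hk1 : k ≠ 1)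
    (h : PowRelation a b g d k) : a = 0 ∧ b = 0 ∧ g = 0 ∧ d = 0 := by
  have hk1' : k - 1 ≠ 0 := sub_ne_zero.mpr hk1
  have h8 : (1 / 8 : ℝ) ∈ Set.Ioo (0 : ℝ) (1 / 4) := by constructor <;> norm_num
  have e1 := h.deriv hk _ _ h8 h8
  have e2 := (h.swap.deriv hk).swap _ _ h8 h8
  have e3 := ((h.deriv hk).deriv hk1') _ _ h8 h8
  have e4 := ((h.deriv hk).swap.deriv hk1') _ _ h8 h8
  push_cast at e1 e2 e3 e4
  norm_num at e1 e2 e3 e4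
  have hA : (5 / 4 : ℂ) ^ (k - 1) = (5 / 4) ^ (k - 1 - 1) * (5 / 4) := by
    rw [Complex.cpow_sub (k - 1) 1 (by norm_num), Complex.cpow_one]; field_simp
  have hD : (3 / 4 : ℂ) ^ (k - 1) = (3 / 4) ^ (k - 1 - 1) * (3 / 4) := by
    rw [Complex.cpow_sub (k - 1) 1 (by norm_num), Complex.cpow_one]; field_simp
  rw [hA, hD] at e1 e2
  have hA0 : (5 / 4 : ℂ) ^ (k - 1 - 1) ≠ 0 := by simp [Complex.cpow_eq_zero_iff]
  have hD0 : (3 / 4 : ℂ) ^ (k - 1 - 1) ≠ 0 := by simp [Complex.cpow_eq_zero_iff]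
  refine ⟨?_, ?_, ?_, ?_⟩
  · refine (mul_eq_zero.mp ?_).resolve_right hA0
    linear_combination (e1 + e2) / 4 + 3 / 16 * (e3 + e4)
  · linear_combination (e1 - e2) / 4 + (e3 - e4) / 4
  · linear_combination (e3 - e4) / 4 - (e1 - e2) / 4
  · refine (mul_eq_zero.mp ?_).resolve_right hD0
    linear_combination 5 / 16 * (e3 + e4) - (e1 + e2) / 4

theorem sq_cpow_half {s : ℝ} (hs : 0 < s) : ((s : ℂ) ^ 2) ^ ((1 : ℂ) / 2) = s := by
  rw [one_div]
  exact Complex.sq_cpow_two_inv (by simpa using hs)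

/-- Small positive real squares lie in `U11`. -/
theorem sq_mem_U11 {s t : ℝ} (hs : s ∈ Set.Ioo (0 : ℝ) (1 / 4))
    (ht : t ∈ Set.Ioo (0 : ℝ) (1 / 4)) : ((s : ℂ) ^ 2, (t : ℂ) ^ 2) ∈ U11 := by
  obtain ⟨hs0, hs1⟩ := hs
  obtain ⟨ht0, ht1⟩ := ht
  refine ⟨?_, ?_, ?_⟩
  · exact_mod_cast Complex.ofReal_mem_slitPlane.mpr (pow_pos hs0 2)
  · exact_mod_cast Complex.ofReal_mem_slitPlane.mpr (pow_pos ht0 2)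
  · rintro e₁ e₂ (rfl | rfl) (rfl | rfl) <;> left <;>
      simp only [sq_cpow_half hs0, sq_cpow_half ht0] <;> simp <;> linarith

/-- For every `c ≠ 0, -1`, the universal basis `f̂₁, f̂₂, f̂₃, f̂₄` of the solution space of
the simplicial Horn system defined by the matrix with rows `(-2,0), (0,-2), (2,2)` is
linearly independent over `ℂ` as functions on `U`. -/
theorem stmt11 (c : ℂ) (hc0 : c ≠ 0) (hc1 : c ≠ -1) (a₁ a₂ a₃ a₄ : ℂ)
    (h : ∀ p ∈ U11,
      a₁ * fsimp 1 1 c p +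
      a₂ * ((fsimp 1 1 c p - fsimp 1 (-1) c p) / c) +
      a₃ * ((fsimp 1 1 c p - fsimp (-1) 1 c p) / c) +
      a₄ * ((fsimp 1 1 c p - fsimp 1 (-1) c p - fsimp (-1) 1 c p + fsimp (-1) (-1) c p) /
        (c + c ^ 2)) = 0) :
    a₁ = 0 ∧ a₂ = 0 ∧ a₃ = 0 ∧ a₄ = 0 := by
  have hcc : c + c ^ 2 ≠ 0 := by
    rw [show c + c ^ 2 = c * (c + 1) by ring]
    exact mul_ne_zero hc0 fun h0 => hc1 (eq_neg_of_add_eq_zero_left h0)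
  have hrel : PowRelation (a₁ + a₂ / c + a₃ / c + a₄ / (c + c ^ 2))
      (-(a₂ / c) - a₄ / (c + c ^ 2)) (-(a₃ / c) - a₄ / (c + c ^ 2)) (a₄ / (c + c ^ 2)) (-c) := by
    intro s t hs ht
    have hp := h _ (sq_mem_U11 hs ht)
    simp only [fsimp, sq_cpow_half hs.1, sq_cpow_half ht.1, one_mul, neg_mul,
      ← sub_eq_add_neg] at hp
    linear_combination hp
  obtain ⟨h₁, h₂, h₃, h₄⟩ := hrel.eq_zero (neg_ne_zero.mpr hc0)
    fun h0 => hc1 (by rw [← h0, neg_neg])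
  have ha₄ : a₄ = 0 := (div_eq_zero_iff.mp h₄).resolve_right hcc
  subst ha₄
  have ha₂ : a₂ = 0 := by simpa [hc0] using h₂
  have ha₃ : a₃ = 0 := by simpa [hc0] using h₃
  subst ha₂ ha₃
  simpa using h₁
end

section
/- For arbitrary c_1, c_2, c_3 ∈ ℂ, the Puiseux monomial f_1(x) = x_1^{c_1 + 2c_2} x_2^{−c_1 − c_2} (principal branches) satisfies both equations of the Horn system generated by the operators x_1(θ_1 + 2θ_2 + c_1) + (θ_1 + θ_2 − c_2) and x_2(θ_1 + 2θ_2 + c_1)(θ_1 + 2θ_2 + c_1 + 1) − (θ_1 + θ_2 − c_2)(θ_2 − c_3), i.e., both operators annihilate f_1 on (ℂ∖(−∞,0])². (The persistent Puiseux monomial solution of the Horn system defined by the matrix with rows (1,2), (−1,−1), (0,−1).) -/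
open scoped BigOperators

/-- The first Horn operator `x₁(θ₁ + 2θ₂ + c₁) + (θ₁ + θ₂ - c₂)`. -/
noncomputable def HornOp1 (c₁ c₂ : ℂ) (f : ℂ × ℂ → ℂ) : ℂ × ℂ → ℂ :=
  fun p => p.1 * lin2 1 2 c₁ f p + lin2 1 1 (-c₂) f p

/-- The second Horn operator
`x₂(θ₁ + 2θ₂ + c₁)(θ₁ + 2θ₂ + c₁ + 1) - (θ₁ + θ₂ - c₂)(θ₂ - c₃)`. -/
noncomputable def HornOp2 (c₁ c₂ c₃ : ℂ) (f : ℂ × ℂ → ℂ) : ℂ × ℂ → ℂ :=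
  fun p => p.2 * lin2 1 2 c₁ (lin2 1 2 (c₁ + 1) f) p -
    lin2 1 1 (-c₂) (fun q => th2 f q - c₃ * f q) p

section PuiseuxMonomial

variable {f : ℂ × ℂ → ℂ} {p : ℂ × ℂ} {α β k : ℂ}

theorem hasFDerivAt_puiseux_monomial (h₁ : p.1 ∈ Complex.slitPlane)
    (h₂ : p.2 ∈ Complex.slitPlane) (α β : ℂ) :
    HasFDerivAt (fun q : ℂ × ℂ => q.1 ^ α * q.2 ^ β)
      (p.1 ^ α • ((β * p.2 ^ (β - 1)) • ContinuousLinearMap.snd ℂ ℂ ℂ) +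
        p.2 ^ β • ((α * p.1 ^ (α - 1)) • ContinuousLinearMap.fst ℂ ℂ ℂ)) p :=
  ((Complex.hasStrictDerivAt_cpow_const h₁).hasDerivAt.comp_hasFDerivAt p hasFDerivAt_fst).mul
    ((Complex.hasStrictDerivAt_cpow_const h₂).hasDerivAt.comp_hasFDerivAt p hasFDerivAt_snd)

theorem th1_of_eventuallyEq_monomial (h₁ : p.1 ∈ Complex.slitPlane)
    (h₂ : p.2 ∈ Complex.slitPlane)
    (hf : f =ᶠ[nhds p] fun q => k * (q.1 ^ α * q.2 ^ β)) :
    th1 f p = α * (k * (p.1 ^ α * p.2 ^ β)) := by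
  have h := ((hasFDerivAt_puiseux_monomial h₁ h₂ α β).const_mul k).congr_of_eventuallyEq hf
  have h0 : p.1 ≠ 0 := Complex.slitPlane_ne_zero h₁
  simp only [th1, h.fderiv]
  simp [Complex.cpow_sub _ _ h0]
  field_simp

theorem th2_of_eventuallyEq_monomial (h₁ : p.1 ∈ Complex.slitPlane)
    (h₂ : p.2 ∈ Complex.slitPlane)
    (hf : f =ᶠ[nhds p] fun q => k * (q.1 ^ α * q.2 ^ β)) :
    th2 f p = β * (k * (p.1 ^ α * p.2 ^ β)) := by
  have h := ((hasFDerivAt_puiseux_monomial h₁ h₂ α β).const_mul k).congr_of_eventuallyEq hf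
  have h0 : p.2 ≠ 0 := Complex.slitPlane_ne_zero h₂
  simp only [th2, h.fderiv]
  simp [Complex.cpow_sub _ _ h0]
  field_simp

/-- Puiseux monomials are eigenfunctions of `a θ₁ + b θ₂ + c`. -/
theorem lin2_of_eventuallyEq_monomial (h₁ : p.1 ∈ Complex.slitPlane)
    (h₂ : p.2 ∈ Complex.slitPlane)
    (hf : f =ᶠ[nhds p] fun q => k * (q.1 ^ α * q.2 ^ β)) (a b c : ℂ) :
    lin2 a b c f p = (a * α + b * β + c) * (k * (p.1 ^ α * p.2 ^ β)) := by
  rw [lin2, th1_of_eventuallyEq_monomial h₁ h₂ hf, th2_of_eventuallyEq_monomial h₁ h₂ hf,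
    hf.eq_of_nhds]
  ring

end PuiseuxMonomial

/-- The persistent Puiseux monomial solution `x₁^{c₁+2c₂} x₂^{-c₁-c₂}` of the Horn system
defined by the matrix with rows `(1,2), (-1,-1), (0,-1)`: both generating operators
annihilate it on `(ℂ ∖ (-∞,0])²`. -/
theorem stmt15 (c₁ c₂ c₃ : ℂ) :
    ∀ p : ℂ × ℂ, p.1 ∈ Complex.slitPlane → p.2 ∈ Complex.slitPlane →
      HornOp1 c₁ c₂ (fun q => q.1 ^ (c₁ + 2 * c₂) * q.2 ^ (-c₁ - c₂)) p = 0 ∧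
      HornOp2 c₁ c₂ c₃ (fun q => q.1 ^ (c₁ + 2 * c₂) * q.2 ^ (-c₁ - c₂)) p = 0 := by
  intro p h₁ h₂
  set α := c₁ + 2 * c₂ with hα
  set β := -c₁ - c₂ with hβ
  have hf (q : ℂ × ℂ) : (fun q : ℂ × ℂ => q.1 ^ α * q.2 ^ β) =ᶠ[nhds q]
      fun q => 1 * (q.1 ^ α * q.2 ^ β) := by simp
  have hU : ∀ᶠ q : ℂ × ℂ in nhds p, q.1 ∈ Complex.slitPlane ∧ q.2 ∈ Complex.slitPlane :=
    (Complex.isOpen_slitPlane.prod Complex.isOpen_slitPlane).mem_nhds ⟨h₁, h₂⟩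
  have hg₁ : lin2 1 2 (c₁ + 1) (fun q : ℂ × ℂ => q.1 ^ α * q.2 ^ β) =ᶠ[nhds p]
      fun q => 1 * (q.1 ^ α * q.2 ^ β) := by
    filter_upwards [hU] with q hq
    rw [lin2_of_eventuallyEq_monomial hq.1 hq.2 (hf q), hα, hβ]
    ring
  have hg₂ : (fun q => th2 (fun q : ℂ × ℂ => q.1 ^ α * q.2 ^ β) q - c₃ * (q.1 ^ α * q.2 ^ β))
      =ᶠ[nhds p] fun q => (β - c₃) * (q.1 ^ α * q.2 ^ β) := by
    filter_upwards [hU] with q hq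
    rw [th2_of_eventuallyEq_monomial hq.1 hq.2 (hf q)]
    ring
  have e₁ : 1 * α + 2 * β + c₁ = 0 := by rw [hα, hβ]; ring
  have e₂ : 1 * α + 1 * β + -c₂ = 0 := by rw [hα, hβ]; ring
  constructor
  · rw [HornOp1, lin2_of_eventuallyEq_monomial h₁ h₂ (hf p),
      lin2_of_eventuallyEq_monomial h₁ h₂ (hf p), e₁, e₂]
    ring
  · rw [HornOp2, lin2_of_eventuallyEq_monomial h₁ h₂ hg₁,
      lin2_of_eventuallyEq_monomial h₁ h₂ hg₂, e₁, e₂]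
    ring
end

section
/- For arbitrary c_1, c_2, c_3 ∈ ℂ, the function g(x) = x_1^{c_1 + 2c_2} x_2^{c_3} (x_1 + x_1² + x_2)^{−(c_1 + c_2 + c_3)} (principal branches) satisfies both equations of the Horn system generated by the operators x_1(θ_1 + 2θ_2 + c_1) + (θ_1 + θ_2 − c_2) and x_2(θ_1 + 2θ_2 + c_1)(θ_1 + 2θ_2 + c_1 + 1) − (θ_1 + θ_2 − c_2)(θ_2 − c_3), on the open set {x ∈ ℂ² : x_1 ∉ (−∞,0], x_2 ∉ (−∞,0], x_1 + x_1² + x_2 ∉ (−∞,0]}. (Together with the monomial x_1^{c_1+2c_2} x_2^{−c_1−c_2}, this yields the basis f_1, f_2 = (f_1 − g)/(c_1+c_2+c_3) of the rank-2 Horn system defined by the matrix with rows (1,2), (−1,−1), (0,−1) for c_1+c_2+c_3 ≠ 0.) -/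
open scoped BigOperators

/-- The polynomial `x₁ + x₁² + x₂`. -/
def hornPoly (q : ℂ × ℂ) : ℂ := q.1 + q.1 ^ 2 + q.2

/-- The function `x₁^α x₂^β (x₁ + x₁² + x₂)^γ`. -/
noncomputable def powProd (α β γ : ℂ) (q : ℂ × ℂ) : ℂ :=
  q.1 ^ α * q.2 ^ β * (q.1 + q.1 ^ 2 + q.2) ^ γ

/-- The domain on which all three principal powers are holomorphic. -/
def hornDomain : Set (ℂ × ℂ) :=
  {q | q.1 ∈ Complex.slitPlane ∧ q.2 ∈ Complex.slitPlane ∧ hornPoly q ∈ Complex.slitPlane}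

theorem isOpen_hornDomain : IsOpen hornDomain := by
  have h := Complex.isOpen_slitPlane
  refine (h.preimage continuous_fst).inter ((h.preimage continuous_snd).inter (h.preimage ?_))
  unfold hornPoly
  fun_prop

theorem hasFDerivAt_hornPoly (p : ℂ × ℂ) :
    HasFDerivAt hornPoly ((1 + 2 * p.1) • ContinuousLinearMap.fst ℂ ℂ ℂ +
      ContinuousLinearMap.snd ℂ ℂ ℂ) p := by
  have h1 : HasFDerivAt (fun q : ℂ × ℂ => q.1) (ContinuousLinearMap.fst ℂ ℂ ℂ) p :=
    hasFDerivAt_fst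
  have h2 : HasFDerivAt (fun q : ℂ × ℂ => q.2) (ContinuousLinearMap.snd ℂ ℂ ℂ) p :=
    hasFDerivAt_snd
  refine ((h1.add (h1.pow 2)).add h2).congr_fderiv ?_
  ext <;> simp

theorem HasFDerivAt.cpow_const_of_mem_slitPlane {f : ℂ × ℂ → ℂ} {f' : ℂ × ℂ →L[ℂ] ℂ} {p : ℂ × ℂ}
    (hf : HasFDerivAt f f' p) (hp : f p ∈ Complex.slitPlane) (γ : ℂ) :
    HasFDerivAt (fun q => f q ^ γ) ((f p ^ γ * (γ / f p)) • f') p := by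
  have h0 := Complex.slitPlane_ne_zero hp
  refine ((Complex.hasStrictDerivAt_cpow_const hp).hasDerivAt.comp_hasFDerivAt p hf).congr_fderiv ?_
  rw [Complex.cpow_sub _ _ h0, Complex.cpow_one]
  congr 1
  ring

theorem hasFDerivAt_powProd (α β γ : ℂ) {p : ℂ × ℂ} (hp : p ∈ hornDomain) :
    HasFDerivAt (powProd α β γ) (powProd α β γ p •
      ((α / p.1 + γ / hornPoly p * (1 + 2 * p.1)) • ContinuousLinearMap.fst ℂ ℂ ℂ +
        (β / p.2 + γ / hornPoly p) • ContinuousLinearMap.snd ℂ ℂ ℂ)) p := by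
  obtain ⟨h1, h2, h3⟩ := hp
  have d1 := (hasFDerivAt_fst (𝕜 := ℂ) (p := p)).cpow_const_of_mem_slitPlane h1 α
  have d2 := (hasFDerivAt_snd (𝕜 := ℂ) (p := p)).cpow_const_of_mem_slitPlane h2 β
  have d3 := (hasFDerivAt_hornPoly p).cpow_const_of_mem_slitPlane h3 γ
  refine ((d1.mul d2).mul d3).congr_fderiv ?_
  ext <;> simp [powProd, hornPoly] <;> ring

theorem th1_mul_powProd (α β γ : ℂ) {p : ℂ × ℂ} (hp : p ∈ hornDomain) {h : ℂ × ℂ → ℂ}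
    {h' : ℂ × ℂ →L[ℂ] ℂ} (hh : HasFDerivAt h h' p) :
    th1 (fun q => h q * powProd α β γ q) p =
      (p.1 * h' (1, 0) + h p * (α + γ * (p.1 + 2 * p.1 ^ 2) / hornPoly p)) * powProd α β γ p := by
  have h0 := Complex.slitPlane_ne_zero hp.1
  have h3 := Complex.slitPlane_ne_zero hp.2.2
  rw [th1, (hh.fun_mul (hasFDerivAt_powProd α β γ hp)).fderiv]
  simp
  field_simp
  ring

theorem th2_mul_powProd (α β γ : ℂ) {p : ℂ × ℂ} (hp : p ∈ hornDomain) {h : ℂ × ℂ → ℂ}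
    {h' : ℂ × ℂ →L[ℂ] ℂ} (hh : HasFDerivAt h h' p) :
    th2 (fun q => h q * powProd α β γ q) p =
      (p.2 * h' (0, 1) + h p * (β + γ * p.2 / hornPoly p)) * powProd α β γ p := by
  have h0 := Complex.slitPlane_ne_zero hp.2.1
  have h3 := Complex.slitPlane_ne_zero hp.2.2
  rw [th2, (hh.fun_mul (hasFDerivAt_powProd α β γ hp)).fderiv]
  simp
  field_simp
  ring

theorem th1_powProd (α β γ : ℂ) {p : ℂ × ℂ} (hp : p ∈ hornDomain) :
    th1 (powProd α β γ) p =
      (α + γ * (p.1 + 2 * p.1 ^ 2) / hornPoly p) * powProd α β γ p := by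
  simpa using th1_mul_powProd α β γ hp (hasFDerivAt_const (1 : ℂ) p)

theorem th2_powProd (α β γ : ℂ) {p : ℂ × ℂ} (hp : p ∈ hornDomain) :
    th2 (powProd α β γ) p = (β + γ * p.2 / hornPoly p) * powProd α β γ p := by
  simpa using th2_mul_powProd α β γ hp (hasFDerivAt_const (1 : ℂ) p)

theorem lin2_congr_of_eqOn (a b c : ℂ) {f g : ℂ × ℂ → ℂ} {s : Set (ℂ × ℂ)} (hs : IsOpen s)
    (hfg : Set.EqOn f g s) {p : ℂ × ℂ} (hp : p ∈ s) : lin2 a b c f p = lin2 a b c g p := by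
  have h := hfg.eventuallyEq_of_mem (hs.mem_nhds hp)
  simp only [lin2, th1, th2, h.fderiv_eq, h.eq_of_nhds]

theorem hasFDerivAt_div_hornPoly {f : ℂ × ℂ → ℂ} {f' : ℂ × ℂ →L[ℂ] ℂ} {p : ℂ × ℂ}
    (hf : HasFDerivAt f f' p) (hp : hornPoly p ≠ 0) :
    HasFDerivAt (fun q => f q / hornPoly q) ((hornPoly p)⁻¹ • f' - (f p / hornPoly p ^ 2) •
      ((1 + 2 * p.1) • ContinuousLinearMap.fst ℂ ℂ ℂ + ContinuousLinearMap.snd ℂ ℂ ℂ)) p := by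
  have hi := (hasDerivAt_inv hp).comp_hasFDerivAt p (hasFDerivAt_hornPoly p)
  simp only [div_eq_mul_inv]
  refine (hf.mul hi).congr_fderiv ?_
  ext <;> simp <;> field_simp <;> ring

/-- The function `g(x) = x₁^{c₁+2c₂} x₂^{c₃} (x₁ + x₁² + x₂)^{-(c₁+c₂+c₃)}` satisfies both
equations of the Horn system defined by the matrix with rows `(1,2), (-1,-1), (0,-1)`. -/
theorem stmt16 (c₁ c₂ c₃ : ℂ) :
    ∀ p : ℂ × ℂ, p.1 ∈ Complex.slitPlane → p.2 ∈ Complex.slitPlane →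
      (p.1 + p.1 ^ 2 + p.2) ∈ Complex.slitPlane →
      HornOp1 c₁ c₂
        (fun q => q.1 ^ (c₁ + 2 * c₂) * q.2 ^ c₃ *
          (q.1 + q.1 ^ 2 + q.2) ^ (-(c₁ + c₂ + c₃))) p = 0 ∧
      HornOp2 c₁ c₂ c₃
        (fun q => q.1 ^ (c₁ + 2 * c₂) * q.2 ^ c₃ *
          (q.1 + q.1 ^ 2 + q.2) ^ (-(c₁ + c₂ + c₃))) p = 0 := by
  intro p hp1 hp2 hp3
  have hp : p ∈ hornDomain := ⟨hp1, hp2, hp3⟩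
  have hS : hornPoly p ≠ 0 := Complex.slitPlane_ne_zero hp3
  set s := c₁ + c₂ + c₃ with hs
  change HornOp1 c₁ c₂ (powProd (c₁ + 2 * c₂) c₃ (-s)) p = 0 ∧
    HornOp2 c₁ c₂ c₃ (powProd (c₁ + 2 * c₂) c₃ (-s)) p = 0
  constructor
  · simp only [HornOp1, lin2, th1_powProd _ _ _ hp, th2_powProd _ _ _ hp]
    field_simp
    simp only [hornPoly, hs]
    ring
  · have e1 : Set.EqOn (lin2 1 2 (c₁ + 1) (powProd (c₁ + 2 * c₂) c₃ (-s)))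
        (fun q => (1 + s * q.1 / hornPoly q) * powProd (c₁ + 2 * c₂) c₃ (-s) q) hornDomain := by
      intro q hq
      have hq0 : hornPoly q ≠ 0 := Complex.slitPlane_ne_zero hq.2.2
      simp only [lin2, th1_powProd _ _ _ hq, th2_powProd _ _ _ hq]
      field_simp
      simp only [hornPoly, hs]
      ring
    have e2 : Set.EqOn (fun q => th2 (powProd (c₁ + 2 * c₂) c₃ (-s)) q -
          c₃ * powProd (c₁ + 2 * c₂) c₃ (-s) q)
        (fun q => (-s * q.2 / hornPoly q) * powProd (c₁ + 2 * c₂) c₃ (-s) q) hornDomain := by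
      intro q hq
      simp only [th2_powProd _ _ _ hq]
      ring
    have d1 := (hasFDerivAt_div_hornPoly
      ((hasFDerivAt_fst (𝕜 := ℂ) (p := p)).const_mul s) hS).const_add 1
    have d2 := hasFDerivAt_div_hornPoly ((hasFDerivAt_snd (𝕜 := ℂ) (p := p)).const_mul (-s)) hS
    rw [HornOp2, lin2_congr_of_eqOn _ _ _ isOpen_hornDomain e1 hp,
      lin2_congr_of_eqOn _ _ _ isOpen_hornDomain e2 hp]
    simp only [lin2, th1_mul_powProd _ _ _ hp d1, th2_mul_powProd _ _ _ hp d1,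
      th1_mul_powProd _ _ _ hp d2, th2_mul_powProd _ _ _ hp d2]
    simp
    field_simp
    simp only [hornPoly, hs]
    ring
end
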